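/- arXiv:1912.06483 — 2 statements merged into one kernel-verified Lean document; each statement's English description precedes it below -/
import Mathlib

section
/- Fix real numbers 1 < α < β and let K be the convex hull of {B̄_1, Ā_1, Ā_2, Ā_3, E_3}. Let q₀ > 0 and let P = (P_1,…,P_4) be a proper 4-system on [q₀,∞) satisfying B̄_1 ∈ K(P) ⊆ K. Then lim_{q→∞} κ_3(q) = 0, where κ_3(q) = (P_4(q) − P_3(q))/q. -/
open Set Filter

noncomputable section

/-- An `n`-system on the interval `I` (conditions (S1)–(S3)). -/
def IsNSystem (n : ℕ) (I : Set ℝ) (P : ℝ → Fin n → ℝ) : Prop :=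
  ∀ q ∈ I,
    ((∀ i, 0 ≤ P q i) ∧ Monotone (P q) ∧ (∑ i, P q i) = q) ∧
    ∃ ε > 0, ∃ k ℓ : Fin n,
      (∀ t ∈ I ∩ Icc (q - ε) q, P t = P q + Pi.single ℓ (t - q)) ∧
      (∀ t ∈ I ∩ Icc q (q + ε), P t = P q + Pi.single k (t - q)) ∧
      (q ∈ interior I → ℓ < k → ∀ i, ℓ ≤ i → i ≤ k → P q i = P q ℓ)

/-- `P` is proper: its first coordinate (equivalently, by (S1)/(G1), each of its
coordinates) tends to infinity with `q`. -/
def IsProper (n : ℕ) (P : ℝ → Fin n → ℝ) : Prop :=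
  ∀ i : Fin n, Tendsto (fun q => P q i) atTop atTop

/-- `F(P)`: the set of accumulation points of `q⁻¹ P(q)` as `q → ∞`. -/
def accPts (n : ℕ) (P : ℝ → Fin n → ℝ) : Set (Fin n → ℝ) :=
  {x | MapClusterPt x atTop fun q : ℝ => q⁻¹ • P q}

/-- `K(P)`: the convex hull of `F(P)`. -/
def Kset (n : ℕ) (P : ℝ → Fin n → ℝ) : Set (Fin n → ℝ) :=
  convexHull ℝ (accPts n P)

def ptA1 (α : ℝ) : Fin 4 → ℝ := ![1, 1, 1, α]
def ptA2 (α : ℝ) : Fin 4 → ℝ := ![1, 1, α, α]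
def ptA3 (α : ℝ) : Fin 4 → ℝ := ![1, 1, α, α ^ 2]
def ptB1 (β : ℝ) : Fin 4 → ℝ := ![1, β, β, β]
noncomputable def ptE3 : Fin 4 → ℝ := ![0, 0, 1/2, 1/2]

/-- `Ā₁ = A₁/|A₁|`, where `|X|` is the sum of the coordinates of `X`. -/
noncomputable def nA1 (α : ℝ) : Fin 4 → ℝ := (3 + α)⁻¹ • ptA1 α
noncomputable def nA2 (α : ℝ) : Fin 4 → ℝ := (2 + 2 * α)⁻¹ • ptA2 α
noncomputable def nA3 (α : ℝ) : Fin 4 → ℝ := (2 + α + α ^ 2)⁻¹ • ptA3 α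
noncomputable def nB1 (β : ℝ) : Fin 4 → ℝ := (1 + 3 * β)⁻¹ • ptB1 β

/-- The convex hull `K` of `{B̄₁, Ā₁, Ā₂, Ā₃, E₃}`. -/
noncomputable def Kbig (α β : ℝ) : Set (Fin 4 → ℝ) :=
  convexHull ℝ {nB1 β, nA1 α, nA2 α, nA3 α, ptE3}

/-- real induction on a half line -/
lemma real_ind (S : ℝ → Prop) (Q : ℝ) (h0 : S Q)
    (hl : ∀ q, Q < q → (∀ t, Q ≤ t → t < q → S t) → S q)
    (hr : ∀ q, Q ≤ q → S q → ∃ ε > 0, ∀ t, q ≤ t → t < q + ε → S t) :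
    ∀ q, Q ≤ q → S q := by
  by_contra hcon
  push Not at hcon
  obtain ⟨b, hb, hSb⟩ := hcon
  set B : Set ℝ := {t | Q ≤ t ∧ ¬ S t} with hB
  have hne : B.Nonempty := ⟨b, hb, hSb⟩
  have hbd : BddBelow B := ⟨Q, fun t ht => ht.1⟩
  have hQ : Q ≤ sInf B := le_csInf hne fun t ht => ht.1
  have hbelow : ∀ t, Q ≤ t → t < sInf B → S t := by
    intro t h1 h2
    by_contra h3
    exact absurd (csInf_le hbd (show t ∈ B from ⟨h1, h3⟩)) (not_le.mpr h2)
  have hS : S (sInf B) := by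
    rcases hQ.eq_or_lt with h | h
    · rw [← h]; exact h0
    · exact hl _ h hbelow
  obtain ⟨ε, hε, hh⟩ := hr _ hQ hS
  obtain ⟨t, ht, htl⟩ := exists_lt_of_csInf_lt hne (show sInf B < sInf B + ε by linarith)
  exact ht.2 (hh t (csInf_le hbd ht) htl)

/-- `k` is the slope index of `P` immediately to the right of `t`. -/
def RS (P : ℝ → Fin 4 → ℝ) (t : ℝ) (k : Fin 4) : Prop :=
  ∃ ε > 0, ∀ u, t ≤ u → u ≤ t + ε → P u = P t + Pi.single k (u - t)

lemma RS_unique {P : ℝ → Fin 4 → ℝ} {t : ℝ} {k l : Fin 4} (hk : RS P t k) (hl : RS P t l) :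
    k = l := by
  obtain ⟨ε, hε, h1⟩ := hk
  obtain ⟨ε', hε', h2⟩ := hl
  have hm : 0 < min ε ε' := lt_min hε hε'
  have e1 := h1 (t + min ε ε') (by linarith) (by linarith [min_le_left ε ε'])
  have e2 := h2 (t + min ε ε') (by linarith) (by linarith [min_le_right ε ε'])
  rw [e1] at e2
  have e3 := congrFun (add_left_cancel e2) k
  by_contra hne
  rw [Pi.single_eq_same, Pi.single_eq_of_ne hne] at e3
  linarith

lemma single_cases (P : ℝ → Fin 4 → ℝ) (t u : ℝ) (k : Fin 4)
    (h : P u = P t + Pi.single k (u - t)) :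
    ∀ i, P u i = P t i + if i = k then u - t else 0 := by
  intro i
  rw [h]
  simp [Pi.single_apply]

/-- The dynamical core. -/
lemma core (q₀ Q β e c δ : ℝ) (P : ℝ → Fin 4 → ℝ) (hP : IsNSystem 4 (Ici q₀) P)
    (hQ : q₀ < Q) (hc : 0 ≤ c) (hδ : 0 ≤ δ)
    (H1 : ∀ q, Q ≤ q → β * P q 0 - P q 1 ≤ e * P q 0 → P q 3 - P q 2 ≤ c * P q 1 + δ * q)
    (H2 : ∀ q, Q ≤ q → P q 1 = P q 2 → P q 3 - P q 2 ≤ c * P q 0 + δ * q →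
      β * P q 0 - P q 1 ≤ e * P q 0)
    (H3 : β * P Q 0 - P Q 1 ≤ e * P Q 0) :
    ∀ q, Q ≤ q → P q 3 - P q 2 ≤ c * P q 1 + δ * q := by
  have key : ∀ q, Q ≤ q → (β * P q 0 - P q 1 ≤ e * P q 0 ∨
      (RS P q 0 ∧ P q 3 - P q 2 ≤ c * P q 1 + δ * q) ∨
      ((RS P q 0 ∨ RS P q 1) ∧ P q 3 - P q 2 ≤ c * P q 0 + δ * q)) := by
    apply real_ind
    · exact Or.inl H3
    · intro q hq hind
      obtain ⟨-, ε, hε, k, l, hl, hk, hS3⟩ := hP q (by simp; linarith)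
      have hS3' := hS3 (by rw [interior_Ici]; simp; linarith)
      have hRSk : RS P q k := ⟨ε, hε, fun u h1 h2 => hk u ⟨by simp; linarith, h1, h2⟩⟩
      set t := max Q (q - ε) with ht
      have htQ : Q ≤ t := le_max_left _ _
      have htε : q - ε ≤ t := le_max_right _ _
      have htq : t < q := max_lt hq (by linarith)
      have hlin : ∀ u, t ≤ u → u ≤ q → P u = P t + Pi.single l (u - t) := by
        intro u h1 h2
        rw [hl u ⟨by simp; linarith, by linarith, h2⟩, hl t ⟨by simp; linarith, htε, htq.le⟩,
          add_assoc, ← Pi.single_add]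
        congr 2; ring
      have hRSl : RS P t l := ⟨q - t, by linarith, fun u h1 h2 => hlin u h1 (by linarith)⟩
      have hv := single_cases P t q l (hlin q htq.le le_rfl)
      have v0 := hv 0
      have v1 := hv 1
      have v2 := hv 2
      have v3 := hv 3
      have hδq : δ * t ≤ δ * q := mul_le_mul_of_nonneg_left htq.le hδ
      -- from low slope with strong bound
      have fin3 : (l = 0 ∨ l = 1) → P q 3 - P q 2 ≤ c * P q 0 + δ * q →
          (β * P q 0 - P q 1 ≤ e * P q 0 ∨
          (RS P q 0 ∧ P q 3 - P q 2 ≤ c * P q 1 + δ * q) ∨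
          ((RS P q 0 ∨ RS P q 1) ∧ P q 3 - P q 2 ≤ c * P q 0 + δ * q)) := by
        intro hl01 hD
        by_cases hk01 : k = 0 ∨ k = 1
        · right; right
          refine ⟨?_, hD⟩
          rcases hk01 with rfl | rfl
          · exact Or.inl hRSk
          · exact Or.inr hRSk
        · left
          apply H2 q hq.le _ hD
          have hlk : l < k := by
            rcases hl01 with rfl | rfl <;> revert hk01 <;> clear * - <;> revert k <;> decide
          have a1 := hS3' hlk 1 (by rcases hl01 with rfl | rfl <;> decide)
            (by revert hk01; clear * -; revert k; decide)
          have a2 := hS3' hlk 2 (by rcases hl01 with rfl | rfl <;> decide)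
            (by revert hk01; clear * -; revert k; decide)
          rw [a1, a2]
      have fin2 : l = 0 → P q 3 - P q 2 ≤ c * P q 1 + δ * q →
          (β * P q 0 - P q 1 ≤ e * P q 0 ∨
          (RS P q 0 ∧ P q 3 - P q 2 ≤ c * P q 1 + δ * q) ∨
          ((RS P q 0 ∨ RS P q 1) ∧ P q 3 - P q 2 ≤ c * P q 0 + δ * q)) := by
        intro hl0 hD
        by_cases hk0 : k = 0
        · subst hk0
          exact Or.inr (Or.inl ⟨hRSk, hD⟩)
        · apply fin3 (Or.inl hl0)
          subst hl0
          have a1 := hS3' (Fin.pos_of_ne_zero hk0) 1 (by decide)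
            (by revert hk0; clear * -; revert k; decide)
          rw [← a1]; exact hD
      rcases hind t htQ htq with h | ⟨h, hD⟩ | ⟨h, hD⟩
      · by_cases hl0 : l = 0
        · apply fin2 hl0
          have := H1 t htQ h
          subst hl0
          simp at v1 v2 v3
          rw [v1, v2, v3]; linarith
        · left
          have : (0 : Fin 4) ≠ l := fun h => hl0 h.symm
          simp [this] at v0
          have : P t 1 ≤ P q 1 := by rw [v1]; split_ifs <;> linarith
          rw [v0]; linarith
      · have hl0 := RS_unique hRSl h
        apply fin2 hl0
        subst hl0
        simp at v1 v2 v3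
        rw [v1, v2, v3]; linarith
      · have hl01 : l = 0 ∨ l = 1 := h.imp (RS_unique hRSl) (RS_unique hRSl)
        apply fin3 hl01
        have h0 : P t 0 ≤ P q 0 := by rw [v0]; split_ifs <;> linarith
        have h0' := mul_le_mul_of_nonneg_left h0 hc
        have : P q 3 - P q 2 = P t 3 - P t 2 := by
          rcases hl01 with rfl | rfl <;> simp at v2 v3 <;> rw [v2, v3]
        linarith
    · intro q hq hS
      obtain ⟨-, ε, hε, k, l, hl, hk, hS3⟩ := hP q (by simp; linarith)
      have hlin0 : ∀ u, q ≤ u → u ≤ q + ε → P u = P q + Pi.single k (u - q) :=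
        fun u h1 h2 => hk u ⟨by simp; linarith, h1, h2⟩
      have hRSk : RS P q k := ⟨ε, hε, hlin0⟩
      refine ⟨ε, hε, fun t h1 h2 => ?_⟩
      have hRSt : RS P t k := by
        refine ⟨q + ε - t, by linarith, fun u h3 h4 => ?_⟩
        rw [hlin0 u (by linarith) (by linarith), hlin0 t h1 h2.le, add_assoc, ← Pi.single_add]
        congr 2; ring
      have hv := single_cases P q t k (hlin0 t h1 h2.le)
      have v0 := hv 0
      have v1 := hv 1
      have v2 := hv 2
      have v3 := hv 3
      have hδq : δ * q ≤ δ * t := mul_le_mul_of_nonneg_left h1 hδ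
      rcases hS with h | ⟨h, hD⟩ | ⟨h, hD⟩
      · by_cases hk0 : k = 0
        · have := H1 q hq h
          subst hk0
          right; left
          refine ⟨hRSt, ?_⟩
          simp at v1 v2 v3
          rw [v1, v2, v3]; linarith
        · left
          have : (0 : Fin 4) ≠ k := fun h => hk0 h.symm
          simp [this] at v0
          have : P q 1 ≤ P t 1 := by rw [v1]; split_ifs <;> linarith
          rw [v0]; linarith
      · have hk0 := RS_unique hRSk h
        subst hk0
        right; left
        refine ⟨hRSt, ?_⟩
        simp at v1 v2 v3
        rw [v1, v2, v3]; linarith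
      · have hk01 : k = 0 ∨ k = 1 := h.imp (RS_unique hRSk) (RS_unique hRSk)
        right; right
        have h0 : P q 0 ≤ P t 0 := by rw [v0]; split_ifs <;> linarith
        have h0' := mul_le_mul_of_nonneg_left h0 hc
        have : P t 3 - P t 2 = P q 3 - P q 2 := by
          rcases hk01 with rfl | rfl <;> simp at v2 v3 <;> rw [v2, v3]
        refine ⟨?_, by linarith⟩
        rcases hk01 with rfl | rfl
        · exact Or.inl hRSt
        · exact Or.inr hRSt
  intro q hq
  rcases key q hq with h | ⟨-, hD⟩ | ⟨-, hD⟩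
  · exact H1 q hq h
  · exact hD
  · obtain ⟨⟨-, hm, -⟩, -⟩ := hP q (by simp; linarith)
    have := mul_le_mul_of_nonneg_left (hm (show (0 : Fin 4) ≤ 1 by decide)) hc
    linarith

/-- linear functional with given coefficients -/
def lf (a b c d : ℝ) (x : Fin 4 → ℝ) : ℝ := a * x 0 + b * x 1 + c * x 2 + d * x 3

lemma lf_cont (a b c d : ℝ) : Continuous (lf a b c d) := by
  unfold lf; fun_prop

lemma lf_smul (a b c d r : ℝ) (x : Fin 4 → ℝ) : lf a b c d (r • x) = r * lf a b c d x := by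
  simp [lf]; ring

lemma lf_hull (a b c d : ℝ) (S : Set (Fin 4 → ℝ)) (h : ∀ x ∈ S, 0 ≤ lf a b c d x) :
    ∀ x ∈ convexHull ℝ S, 0 ≤ lf a b c d x := by
  have hc : Convex ℝ {x | 0 ≤ lf a b c d x} := by
    intro x hx y hy r s hr hs _
    simp only [mem_ofPred_eq] at *
    have : lf a b c d (r • x + s • y) = r * lf a b c d x + s * lf a b c d y := by
      simp [lf]; ring
    rw [this]; positivity
  exact fun x hx => convexHull_min h hc hx

lemma ev_lf (q₀ : ℝ) (hq₀ : 0 < q₀) (P : ℝ → Fin 4 → ℝ) (hP : IsNSystem 4 (Ici q₀) P)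
    (a b c d δ : ℝ) (hδ : 0 < δ) (h : ∀ x ∈ accPts 4 P, 0 ≤ lf a b c d x) :
    ∀ᶠ q in atTop, -(δ * q) ≤ lf a b c d (P q) := by
  by_contra hcon
  rw [not_eventually] at hcon
  set K : Set (Fin 4 → ℝ) := Set.pi univ (fun _ => Icc (0 : ℝ) 1) ∩ {x | lf a b c d x ≤ -δ}
    with hK
  have hKc : IsCompact K :=
    (isCompact_univ_pi fun _ => isCompact_Icc).inter_right
      (isClosed_le (lf_cont a b c d) continuous_const)
  have hfr : ∃ᶠ q in atTop, q⁻¹ • P q ∈ K := by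
    refine (hcon.and_eventually (eventually_ge_atTop q₀)).mono ?_
    rintro q ⟨h1, h2⟩
    have hq : 0 < q := by linarith
    obtain ⟨⟨hn, hm, hs⟩, -⟩ := hP q h2
    refine ⟨fun i _ => ?_, ?_⟩
    · have hle : P q i ≤ q := by
        rw [← hs]; nth_rewrite 1 [hs]
        exact Finset.single_le_sum (f := P q) (fun j _ => hn j) (Finset.mem_univ i)
      simp only [Pi.smul_apply, smul_eq_mul, mem_Icc]
      refine ⟨mul_nonneg (by positivity) (hn i), ?_⟩
      rw [inv_mul_le_iff₀ hq]; linarith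
    · simp only [mem_ofPred_eq, lf_smul]
      rw [inv_mul_le_iff₀ hq]; push Not at h1; linarith
  obtain ⟨x, hx, hxc⟩ := hKc.exists_mapClusterPt_of_frequently hfr
  have := h x hxc
  have h2 : lf a b c d x ≤ -δ := hx.2
  linarith

lemma fr_lf (P : ℝ → Fin 4 → ℝ) (a b c d : ℝ) (z : Fin 4 → ℝ) (hz : z ∈ Kset 4 P)
    (hneg : lf a b c d z < 0) :
    ∃ᶠ q in atTop, lf a b c d (P q) < 0 := by
  have : ∃ x ∈ accPts 4 P, lf a b c d x < 0 := by
    by_contra hcon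
    push Not at hcon
    exact absurd (lf_hull a b c d _ hcon z hz) (not_le.mpr hneg)
  obtain ⟨x, hx, hxn⟩ := this
  have hx' : MapClusterPt x atTop fun q : ℝ => q⁻¹ • P q := hx
  have hfr := hx'.frequently ((lf_cont a b c d).continuousAt.eventually_lt_const hxn)
  refine (hfr.and_eventually (eventually_gt_atTop 0)).mono ?_
  rintro q ⟨h1, h2⟩
  rw [lf_smul] at h1
  by_contra h3
  push Not at h3
  have : 0 ≤ q⁻¹ * lf a b c d (P q) := by positivity
  linarith

lemma Kbig_lf (α β : ℝ) (hα : 1 < α) (hβ : 1 < β) (a b c d : ℝ)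
    (hB : 0 ≤ lf a b c d (ptB1 β)) (h1 : 0 ≤ lf a b c d (ptA1 α))
    (h2 : 0 ≤ lf a b c d (ptA2 α)) (h3 : 0 ≤ lf a b c d (ptA3 α))
    (hE : 0 ≤ lf a b c d ptE3) : ∀ x ∈ Kbig α β, 0 ≤ lf a b c d x := by
  apply lf_hull
  intro x hx
  simp only [mem_insert_iff, mem_singleton_iff] at hx
  rcases hx with rfl | rfl | rfl | rfl | rfl
  · rw [nB1, lf_smul]; positivity
  · rw [nA1, lf_smul]; positivity
  · rw [nA2, lf_smul]; positivity
  · rw [nA3, lf_smul]; positivity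
  · exact hE

set_option maxHeartbeats 1000000 in
/-- quantitative version -/
lemma quant (α β : ℝ) (hα : 1 < α) (hαβ : α < β) (q₀ : ℝ) (hq₀ : 0 < q₀)
    (P : ℝ → Fin 4 → ℝ) (hP : IsNSystem 4 (Ici q₀) P)
    (hB : nB1 β ∈ Kset 4 P) (hK : Kset 4 P ⊆ Kbig α β) (e : ℝ) (he : 0 < e)
    (he2 : e ≤ (β - α) / 2) (δ₀ : ℝ) (hδ₀ : 0 < δ₀) :
    ∀ᶠ q in atTop, P q 3 - P q 2 ≤
      (α * ((α - 1) / (β - 1)) * e / ((α + β) / 2) + δ₀) * q := by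
  have hβ : 1 < β := hα.trans hαβ
  have hb1 : 0 < β - 1 := by linarith
  set n := (α - 1) / (β - 1) with hn
  have hnpos : 0 < n := div_pos (by linarith) hb1
  have hnb : n * (β - 1) = α - 1 := div_mul_cancel₀ _ hb1.ne'
  set γ := (α + β) / 2 with hγ
  have hγpos : 0 < γ := by rw [hγ]; linarith
  set c := α * n * e / γ with hc
  have hcγ : c * γ = α * n * e := div_mul_cancel₀ _ hγpos.ne'
  have hcpos : 0 < c := by positivity
  have hgap : 0 < n * e - c := by
    have h1 : (n * e - c) * γ = n * e * (γ - α) := by rw [sub_mul, hcγ]; ring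
    have h2 : 0 < n * e * (γ - α) := mul_pos (by positivity) (by rw [hγ]; linarith)
    rw [← h1] at h2
    exact (pos_iff_pos_of_mul_pos h2).mpr hγpos
  set C := 2 * (1 + (2 + α) * β) with hC
  have hCpos : 0 < C := by positivity
  obtain ⟨δ, hδ, hδ1, hδ2, hδ3⟩ : ∃ δ > 0, δ ≤ δ₀ ∧ 2 * δ * C ≤ n * e - c ∧
      2 * (3 + α) * δ ≤ 1 := by
    refine ⟨min δ₀ (min ((n * e - c) / (2 * C)) (1 / (2 * (3 + α)))), by positivity,
      min_le_left _ _, ?_, ?_⟩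
    · have := (min_le_right δ₀ _).trans (min_le_left ((n * e - c) / (2 * C)) (1 / (2 * (3 + α))))
      rw [le_div_iff₀ (by positivity)] at this
      linarith
    · have := (min_le_right δ₀ _).trans (min_le_right ((n * e - c) / (2 * C)) (1 / (2 * (3 + α))))
      rw [le_div_iff₀ (by positivity)] at this
      linarith
  have hacc : ∀ x ∈ accPts 4 P, x ∈ Kbig α β := fun x hx => hK (subset_convexHull ℝ _ hx)
  -- the four inequalities
  have E1 := ev_lf q₀ hq₀ P hP (α * n * β) (-(α * n)) 1 (-1) δ hδ
    (fun x hx => Kbig_lf α β hα hβ _ _ _ _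
      (by simp [lf, ptB1])
      (by simp [lf, ptA1]; nlinarith)
      (by simp [lf, ptA2]; nlinarith)
      (by simp [lf, ptA3]; nlinarith)
      (by simp [lf, ptE3]) x (hacc x hx))
  have E2 := ev_lf q₀ hq₀ P hP (-(n * β)) (n - 1) 0 1 δ hδ
    (fun x hx => Kbig_lf α β hα hβ _ _ _ _
      (by simp [lf, ptB1]; nlinarith)
      (by simp [lf, ptA1]; nlinarith)
      (by simp [lf, ptA2]; nlinarith)
      (by simp [lf, ptA3]; nlinarith)
      (by simp [lf, ptE3]) x (hacc x hx))
  have E3 := ev_lf q₀ hq₀ P hP 0 0 α (-1) δ hδ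
    (fun x hx => Kbig_lf α β hα hβ _ _ _ _
      (by simp [lf, ptB1]; nlinarith)
      (by simp [lf, ptA1])
      (by simp [lf, ptA2]; nlinarith)
      (by simp [lf, ptA3]; nlinarith)
      (by simp [lf, ptE3]; linarith) x (hacc x hx))
  have E4 := ev_lf q₀ hq₀ P hP β (-1) 0 0 δ hδ
    (fun x hx => Kbig_lf α β hα hβ _ _ _ _
      (by simp [lf, ptB1])
      (by simp [lf, ptA1]; nlinarith)
      (by simp [lf, ptA2]; nlinarith)
      (by simp [lf, ptA3]; nlinarith)
      (by simp [lf, ptE3]) x (hacc x hx))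
  have F := fr_lf P (β - e) (-1) 0 0 _ hB (by
    rw [nB1, lf_smul]
    have : lf (β - e) (-1) 0 0 (ptB1 β) = -e := by simp [lf, ptB1]; ring
    rw [this]
    have : 0 < (1 + 3 * β)⁻¹ := by positivity
    nlinarith)
  obtain ⟨Q₁, hQ₁⟩ := eventually_atTop.mp (E1.and (E2.and (E3.and E4)))
  obtain ⟨Q, hQF, hQ⟩ := (F.and_eventually (eventually_gt_atTop (max q₀ Q₁))).exists
  have hQq : q₀ < Q := (le_max_left _ _).trans_lt hQ
  have hQQ : Q₁ < Q := (le_max_right _ _).trans_lt hQ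
  have main := core q₀ Q β e c δ P hP hQq hcpos.le hδ.le ?_ ?_ ?_
  · filter_upwards [eventually_ge_atTop Q] with q hq
    obtain ⟨⟨hp, hm, hs⟩, -⟩ := hP q (by simp; linarith)
    have h := main q hq
    have h1 : P q 1 ≤ q := by
      have := Finset.single_le_sum (f := P q) (fun j _ => hp j) (Finset.mem_univ 1)
      linarith
    have h2 := mul_le_mul_of_nonneg_left h1 hcpos.le
    have h3 := mul_le_mul_of_nonneg_right hδ1 (show 0 ≤ q by linarith)
    linarith
  · intro q hq hb
    obtain ⟨e1, -⟩ := hQ₁ q (by linarith)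
    obtain ⟨⟨hp, hm, hs⟩, -⟩ := hP q (by simp; linarith)
    simp only [lf] at e1
    have h1 : γ * P q 0 ≤ P q 1 := by
      have : γ * P q 0 ≤ (β - e) * P q 0 :=
        mul_le_mul_of_nonneg_right (by rw [hγ]; linarith) (hp 0)
      linarith
    have h2 := mul_le_mul_of_nonneg_left h1 hcpos.le
    have h3 := mul_le_mul_of_nonneg_left hb (show 0 ≤ α * n by positivity)
    have h4 : c * (γ * P q 0) = α * n * (e * P q 0) := by rw [← mul_assoc, hcγ]; ring
    linarith
  · intro q hq h12 hD
    obtain ⟨-, e2, e3, e4⟩ := hQ₁ q (by linarith)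
    obtain ⟨⟨hp, hm, hs⟩, -⟩ := hP q (by simp; linarith)
    simp only [lf] at e2 e3 e4
    rw [Fin.sum_univ_four] at hs
    have hq0 : 0 < q := by linarith
    have a1 : P q 1 ≤ β * P q 0 + δ * q := by linarith
    have a2 := mul_le_mul_of_nonneg_left a1 (show 0 ≤ 2 + α by linarith)
    have a3 := mul_le_mul_of_nonneg_right hδ3 hq0.le
    have hqC : q ≤ C * P q 0 := by
      rw [hC]
      rw [← h12] at hs e3
      linarith
    have a4 := mul_le_mul_of_nonneg_left hqC (show 0 ≤ 2 * δ by linarith)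
    have a5 := mul_le_mul_of_nonneg_right hδ2 (hp 0)
    have a6 : n * (β * P q 0 - P q 1) ≤ n * (e * P q 0) := by
      rw [← h12] at hD
      linarith
    exact le_of_mul_le_mul_left a6 hnpos
  · simp only [lf] at hQF
    linarith

theorem stmt_17 (α β : ℝ) (hα : 1 < α) (hαβ : α < β) (q₀ : ℝ) (hq₀ : 0 < q₀)
    (P : ℝ → Fin 4 → ℝ) (hP : IsNSystem 4 (Ici q₀) P) (hprop : IsProper 4 P)
    (hB : nB1 β ∈ Kset 4 P) (hK : Kset 4 P ⊆ Kbig α β) :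
    Tendsto (fun q => (P q 3 - P q 2) / q) atTop (nhds 0) := by
  have hβ : 1 < β := hα.trans hαβ
  have hb1 : 0 < β - 1 := by linarith
  set M := α * ((α - 1) / (β - 1)) / ((α + β) / 2) with hM
  have hMpos : 0 < M := by
    have : 0 < α - 1 := by linarith
    positivity
  rw [Metric.tendsto_nhds]
  intro ε hε
  have hba : 0 < (β - α) / 2 := by linarith
  set e := min ((β - α) / 2) (ε / (4 * M)) with he
  have hepos : 0 < e := by positivity
  have hMe : M * e ≤ ε / 4 := by
    have := min_le_right ((β - α) / 2) (ε / (4 * M))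
    rw [← he, le_div_iff₀ (by positivity)] at this
    linarith
  have hq := quant α β hα hαβ q₀ hq₀ P hP hB hK e hepos (min_le_left _ _) (ε / 4) (by positivity)
  filter_upwards [hq, eventually_ge_atTop q₀] with q h1 h2
  have hq0 : 0 < q := by linarith
  obtain ⟨⟨hp, hm, hs⟩, -⟩ := hP q h2
  have h3 : P q 2 ≤ P q 3 := hm (by decide)
  have h4 : α * ((α - 1) / (β - 1)) * e / ((α + β) / 2) = M * e := by rw [hM]; ring
  rw [h4] at h1
  rw [Real.dist_eq, sub_zero, abs_of_nonneg (div_nonneg (by linarith) hq0.le), div_lt_iff₀ hq0]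
  have := mul_le_mul_of_nonneg_right hMe hq0.le
  nlinarith
end
end

section
/- Fix an integer n ≥ 4, a real number α > 1, set β = 1 + α + ⋯ + α^{n−2}, and let T = (T_1,…,T_{n+1}): ℝ^n → ℝ^{n+1} be the linear map with T_1(x) = x_1, T_j(x) = αx_j − x_{j+1} for 2 ≤ j ≤ n−1, T_n(x) = x_n − α^{n−3}x_2, T_{n+1}(x) = x_n − α^{n−2}x_1. Let E be the set of all real numbers θ for which there exist q₀ ≥ 0 and a proper n-system P: [q₀,∞) → ℝ^n with μ_T(P) = (θ, 0, …, 0). Then E = {0} ∪ {(1 + α^m β)^{−1} : m a positive integer}. -/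
open Set Filter

noncomputable section

/-- `μ_T(P) = (liminf q⁻¹ T₁(P(q)), …, liminf q⁻¹ Tₘ(P(q)))`. -/
def muVec {n m : ℕ} (T : (Fin n → ℝ) → Fin m → ℝ) (P : ℝ → Fin n → ℝ) : Fin m → ℝ :=
  fun i => liminf (fun q : ℝ => T (P q) i / q) atTop

/-- The linear map `T = (T₁,…,T_{n+1}) : ℝⁿ → ℝ^{n+1}` of Section 5 (indices of
coordinates are shifted down by one: `x ⟨j-1,_⟩` is the paper's `x_j`). -/
def Tbig (n : ℕ) (hn : 4 ≤ n) (α : ℝ) (x : Fin n → ℝ) : Fin (n + 1) → ℝ :=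
  fun j =>
    if (j : ℕ) = 0 then x ⟨0, by omega⟩
    else if h : (j : ℕ) ≤ n - 2 then
      α * x ⟨(j : ℕ), by omega⟩ - x ⟨(j : ℕ) + 1, by omega⟩
    else if (j : ℕ) = n - 1 then
      x ⟨n - 1, by omega⟩ - α ^ (n - 3) * x ⟨1, by omega⟩
    else x ⟨n - 1, by omega⟩ - α ^ (n - 2) * x ⟨0, by omega⟩


/-- Moving index to the right of `q` is `k`. -/
def Rt {n : ℕ} (P : ℝ → Fin n → ℝ) (k : Fin n) (q : ℝ) : Prop :=
  ∃ ε > 0, ∀ y ∈ Icc q (q + ε), P y = P q + Pi.single k (y - q)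

lemma single_le_abs {n : ℕ} (k i : Fin n) (d : ℝ) : |(Pi.single k d : Fin n → ℝ) i| ≤ |d| := by
  by_cases h : i = k
  · subst h; simp
  · simp [Pi.single_eq_of_ne h]

lemma Rt.unique {n : ℕ} {P : ℝ → Fin n → ℝ} {k k' : Fin n} {q : ℝ}
    (h : Rt P k q) (h' : Rt P k' q) : k = k' := by
  obtain ⟨e, he, H⟩ := h
  obtain ⟨e', he', H'⟩ := h'
  by_contra hne
  have hm : 0 < min e e' := lt_min he he'
  have h1 := H (q + min e e') ⟨by linarith, by linarith [min_le_left e e']⟩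
  have h2 := H' (q + min e e') ⟨by linarith, by linarith [min_le_right e e']⟩
  have h3 := congrFun (h1.symm.trans h2) k
  simp [Pi.single_eq_of_ne hne] at h3
  linarith

section struct
variable {n : ℕ} {q₀ : ℝ} {P : ℝ → Fin n → ℝ}

lemma nsys_cont (hP : IsNSystem n (Ici q₀) P) (i : Fin n) :
    ContinuousOn (fun q => P q i) (Ici q₀) := by
  intro q hq
  obtain ⟨_, e, he, k, l, hl, hk, _⟩ := hP q hq
  rw [Metric.continuousWithinAt_iff]
  intro d hd
  refine ⟨min e d, lt_min he hd, ?_⟩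
  intro x hx hxd
  rw [Real.dist_eq] at hxd ⊢
  have h1 : |x - q| < e := lt_of_lt_of_le hxd (min_le_left _ _)
  have h2 : |x - q| < d := lt_of_lt_of_le hxd (min_le_right _ _)
  rw [abs_lt] at h1
  refine lt_of_le_of_lt ?_ h2
  rcases le_total x q with h | h
  · rw [hl x ⟨hx, by constructor <;> linarith⟩]
    simpa using single_le_abs l i (x - q)
  · rw [hk x ⟨hx, by constructor <;> linarith⟩]
    simpa using single_le_abs k i (x - q)

lemma nsys_rt (hP : IsNSystem n (Ici q₀) P) {q : ℝ} (hq : q₀ ≤ q) : ∃ k, Rt P k q := by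
  obtain ⟨_, e, he, k, l, hl, hk, _⟩ := hP q hq
  exact ⟨k, e, he, fun y hy => hk y ⟨le_trans hq hy.1, hy⟩⟩

lemma nsys_mono (hP : IsNSystem n (Ici q₀) P) (i : Fin n) {a b : ℝ} (ha : q₀ ≤ a) (hab : a ≤ b) :
    P a i ≤ P b i := by
  have hc : IsClosed ({x | P a i ≤ P x i} ∩ Icc a b) := by
    have : ContinuousOn (fun q => P q i) (Icc a b) :=
      (nsys_cont hP i).mono (fun x hx => le_trans ha hx.1)
    have h2 := this.preimage_isClosed_of_isClosed isClosed_Icc (isClosed_Ici (a := P a i))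
    rw [inter_comm]
    exact h2
  have := hc.Icc_subset_of_forall_exists_gt (a := a) (b := b) (by simp) (by
    rintro x ⟨hx, hxa, hxb⟩ y hy
    obtain ⟨k, e, he, H⟩ := nsys_rt hP (le_trans ha hxa)
    have hy' : x < y := hy
    refine ⟨min y (x + e), ?_, ?_, min_le_left _ _⟩
    · have hm : x < min y (x + e) := lt_min hy' (by linarith)
      have := H (min y (x + e)) ⟨hm.le, min_le_right _ _⟩
      have h2 := congrFun this i
      simp only [Pi.add_apply] at h2
      have h3 : 0 ≤ (Pi.single k (min y (x + e) - x) : Fin n → ℝ) i := by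
        by_cases h : i = k
        · subst h; simp only [Pi.single_eq_same]; linarith
        · simp [Pi.single_eq_of_ne h]
      simp only [mem_ofPred_eq] at hx ⊢
      linarith
    · exact lt_min hy' (by linarith))
  exact this (right_mem_Icc.mpr hab)

/-- Follow the system from `s` as long as the coordinates in `J` stay constant. -/
lemma nsys_max (hP : IsNSystem n (Ici q₀) P) (hp : IsProper n P) (J : Set (Fin n))
    (hJ : J.Nonempty) {s : ℝ} (hs : q₀ ≤ s) :
    ∃ τ, s ≤ τ ∧ (∀ y ∈ Icc s τ, ∀ i ∈ J, P y i = P s i) ∧ ∃ k ∈ J, Rt P k τ := by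
  obtain ⟨j, hj⟩ := hJ
  set X : Set ℝ := {x | s ≤ x ∧ ∀ y ∈ Icc s x, ∀ i ∈ J, P y i = P s i} with hX
  have hne : s ∈ X := by
    refine ⟨le_rfl, ?_⟩
    intro y hy i _
    have : y = s := le_antisymm hy.2 hy.1
    rw [this]
  obtain ⟨b, hb⟩ := Filter.eventually_atTop.mp ((hp j).eventually_gt_atTop (P s j))
  have hbd : BddAbove X := by
    refine ⟨max b s, ?_⟩
    rintro x ⟨hsx, hx⟩
    by_contra hcon
    push Not at hcon
    have h1 := hx x ⟨hsx, le_rfl⟩ j hj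
    have h2 := hb x (le_trans (le_max_left _ _) hcon.le)
    linarith
  have hsτ : s ≤ sSup X := le_csSup hbd hne
  have hlt : ∀ y, s ≤ y → y < sSup X → ∀ i ∈ J, P y i = P s i := by
    intro y hy hyX
    obtain ⟨x, hx, hyx⟩ := exists_lt_of_lt_csSup ⟨s, hne⟩ hyX
    exact hx.2 y ⟨hy, hyx.le⟩
  have heq : ∀ i ∈ J, P (sSup X) i = P s i := by
    intro i hi
    rcases eq_or_lt_of_le hsτ with h | h
    · rw [← h]
    · have hcont : ContinuousOn (fun q => P q i) (Icc s (sSup X)) :=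
        (nsys_cont hP i).mono (fun x hx => le_trans hs hx.1)
      have hcl : IsClosed (Icc s (sSup X) ∩ (fun q => P q i) ⁻¹' {P s i}) :=
        hcont.preimage_isClosed_of_isClosed isClosed_Icc isClosed_singleton
      have hsub : Ico s (sSup X) ⊆ Icc s (sSup X) ∩ (fun q => P q i) ⁻¹' {P s i} := by
        intro y hy
        exact ⟨⟨hy.1, hy.2.le⟩, hlt y hy.1 hy.2 i hi⟩
      have h2 := closure_minimal hsub hcl
      rw [closure_Ico h.ne] at h2
      exact (h2 (right_mem_Icc.mpr hsτ)).2
  have hall : ∀ y ∈ Icc s (sSup X), ∀ i ∈ J, P y i = P s i := by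
    intro y hy i hi
    rcases eq_or_lt_of_le hy.2 with h | h
    · rw [h]; exact heq i hi
    · exact hlt y hy.1 h i hi
  refine ⟨sSup X, hsτ, hall, ?_⟩
  obtain ⟨k, hk⟩ := nsys_rt hP (le_trans hs hsτ)
  refine ⟨k, ?_, hk⟩
  by_contra hkJ
  obtain ⟨e, he, H⟩ := hk
  have : sSup X + e ∈ X := by
    refine ⟨by linarith, ?_⟩
    intro y hy i hi
    rcases le_total y (sSup X) with h | h
    · exact hall y ⟨hy.1, h⟩ i hi
    · rw [H y ⟨h, hy.2⟩]
      have : i ≠ k := fun h => hkJ (h ▸ hi)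
      simp [Pi.single_eq_of_ne this, heq i hi]
  have := le_csSup hbd this
  linarith

/-- If the coordinates above `j` were constant just before `x`, then the moving index to the right
of `x` is at most `j'` as soon as `P_{j'}(x) < P_{j'+1}(x)`, `j ≤ j'`. -/
lemma nsys_transfer (hP : IsNSystem n (Ici q₀) P) {a x : ℝ} (ha : q₀ ≤ a) (hax : a < x)
    {j j' j'' : Fin n} (hjj : j ≤ j') (hjs : (j'' : ℕ) = j' + 1)
    (hc : ∀ y ∈ Icc a x, ∀ i, j < i → P y i = P a i) (hlt : P x j' < P x j'')
    {k : Fin n} (hk : Rt P k x) : k ≤ j' := by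
  obtain ⟨_, e, he, k', l, hl, hk', hS⟩ := hP x (le_trans ha hax.le)
  have hkk : k = k' := by
    refine hk.unique ⟨e, he, fun y hy => hk' y ⟨?_, hy⟩⟩
    exact le_trans (le_trans ha hax.le) hy.1
  subst hkk
  have hlj : l ≤ j := by
    by_contra hcon
    push Not at hcon
    set y := max a (x - e) with hy
    have hyx : y < x := max_lt hax (by linarith)
    have h1 := hl y ⟨le_trans ha (le_max_left _ _), le_max_right _ _, hyx.le⟩
    have h2 := congrFun h1 l
    rw [hc y ⟨le_max_left _ _, hyx.le⟩ l hcon] at h2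
    simp only [Pi.add_apply, Pi.single_eq_same] at h2
    rw [hc x ⟨hax.le, le_rfl⟩ l hcon] at h2
    linarith
  by_contra hcon
  push Not at hcon
  have hint : x ∈ interior (Ici q₀) := by
    rw [interior_Ici]; exact lt_of_le_of_lt ha hax
  have hlj' := le_trans hlj hjj
  have h1 := hS hint (lt_of_le_of_lt hlj' hcon) j' hlj' hcon.le
  have h2 := hS hint (lt_of_le_of_lt hlj' hcon) j'' (by
    rw [Fin.le_def] at *; omega) (by rw [Fin.lt_def] at hcon; rw [Fin.le_def]; omega)
  linarith

/-- If the moving index at `s` is `≤ j`, then it stays so until `P_j = P_{j+1}`. -/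
lemma nsys_next (hP : IsNSystem n (Ici q₀) P) (hp : IsProper n P) {s : ℝ} (hs : q₀ ≤ s)
    {j j' k : Fin n} (hj : (j' : ℕ) = j + 1) (hk : Rt P k s) (hkj : k ≤ j) :
    ∃ σ, s < σ ∧ (∀ y ∈ Icc s σ, ∀ i, j < i → P y i = P s i) ∧ P σ j = P σ j' := by
  obtain ⟨σ, hsσ, hc, k', hk'J, hk'⟩ := nsys_max hP hp {i | j < i}
    ⟨j', by simp only [mem_ofPred_eq, Fin.lt_def]; omega⟩ hs
  have hne : s < σ := by
    refine lt_of_le_of_ne hsσ ?_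
    rintro rfl
    have := hk.unique hk'
    subst this
    exact absurd hk'J (not_lt.mpr hkj)
  refine ⟨σ, hne, hc, ?_⟩
  have hm := (hP σ (le_trans hs hsσ)).1.2.1 (show j ≤ j' by rw [Fin.le_def]; omega)
  refine le_antisymm hm ?_
  by_contra hcon
  push Not at hcon
  have := nsys_transfer hP hs hne le_rfl hj hc hcon hk'
  exact absurd hk'J (not_lt.mpr this)

end struct

lemma sum_weights (n : ℕ) (hn : 0 < n) (α x : ℝ) :
    ∑ i : Fin n, (if (i : ℕ) = 0 then 1 else x * α ^ ((i : ℕ) - 1)) =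
      1 + x * ∑ i ∈ Finset.range (n - 1), α ^ i := by
  obtain ⟨n', rfl⟩ : ∃ n', n = n' + 1 := ⟨n - 1, by omega⟩
  rw [Fin.sum_univ_succ]
  simp only [Fin.val_zero, if_true, Fin.val_succ, Nat.add_sub_cancel, Nat.succ_ne_zero, if_false]
  rw [← Finset.mul_sum, Fin.sum_univ_eq_sum_range (fun i => α ^ i)]

/-- Asymptotic inequalities, made multiplicative, valid from `Q` on. -/
structure Approx (n : ℕ) (α κ c Q : ℝ) (P : ℝ → Fin n → ℝ) (i0 i1 i2 i3 : Fin n) : Prop where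
  v0 : (i0 : ℕ) = 0
  v1 : (i1 : ℕ) = 1
  v2 : (i2 : ℕ) = 2
  v3 : (i3 : ℕ) = 3
  hα : 1 < α
  hκ : 1 < κ
  hκα : κ ^ 3 < α
  hc : 0 < c
  hQ : 0 < Q
  h0 : ∀ q, Q ≤ q → c * q ≤ P q i0
  h12 : ∀ q, Q ≤ q → P q i2 ≤ α * κ * P q i1
  h23 : ∀ q, Q ≤ q → P q i3 ≤ α * κ * P q i2
  h13 : ∀ q, Q ≤ q → α * P q i1 ≤ κ * P q i3
  hlo : ∀ q, Q ≤ q → ∀ j : Fin n, 1 ≤ (j : ℕ) → α ^ ((j : ℕ) - 1) * P q i0 ≤ κ * P q j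
  hhi : ∀ q, Q ≤ q → ∀ j : Fin n, 1 ≤ (j : ℕ) → P q j ≤ κ * α ^ ((j : ℕ) - 1) * P q i1

section core
variable {n : ℕ} {q₀ : ℝ} {P : ℝ → Fin n → ℝ} {α κ c Q : ℝ} {i0 i1 i2 i3 : Fin n}

set_option maxHeartbeats 1000000 in
lemma Approx.step (H : Approx n α κ c Q P i0 i1 i2 i3) (hP : IsNSystem n (Ici q₀) P)
    (hp : IsProper n P) (hq : q₀ ≤ Q) {s : ℝ} (hs : Q ≤ s) {k : Fin n} (hk : Rt P k s)
    (hk2 : k ≤ i2) :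
    ∃ s', s < s' ∧ (∃ k', k' ≤ i2 ∧ Rt P k' s') ∧
      α * P s i3 ≤ κ ^ 3 * P s' i3 ∧ P s' i3 ≤ κ ^ 3 * (α * P s i3) ∧
      ∀ t ∈ Icc s s', P t i0 = P t i1 → P t i3 = P s i3 ∨
        (α * P s i3 ≤ κ ^ 3 * P t i3 ∧ P t i3 ≤ κ ^ 3 * (α * P s i3)) := by
  have hα := H.hα
  have hκ := H.hκ
  have hκα := H.hκα
  have hκ2 : 1 < κ ^ 2 := by nlinarith
  have hκ3 : κ ^ 2 < κ ^ 3 := by nlinarith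
  have hκ1 : κ < κ ^ 2 := by nlinarith
  have v0 := H.v0
  have v1 := H.v1
  have v2 := H.v2
  have v3 := H.v3
  have hpos : ∀ q, Q ≤ q → ∀ i, 0 < P q i := by
    intro q hqq i
    have h1 := H.h0 q hqq
    have h2 := (hP q (le_trans hq hqq)).1.2.1 (show i0 ≤ i by rw [Fin.le_def]; omega)
    have : 0 < c * q := mul_pos H.hc (lt_of_lt_of_le H.hQ hqq)
    linarith
  -- P_3 = P_4 event
  obtain ⟨σ, hsσ, hcσ, hσ⟩ := nsys_next hP hp (le_trans hq hs) (j := i2) (j' := i3)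
    (by omega) hk hk2
  have hQσ : Q ≤ σ := by linarith
  have hWσ : P σ i3 = P s i3 := hcσ σ ⟨hsσ.le, le_rfl⟩ i3 (by rw [Fin.lt_def]; omega)
  set W := P s i3 with hW
  have hWpos : 0 < W := hpos s hs i3
  have hσ2 : P σ i2 = W := by rw [hσ, hWσ]
  have e1 : α * P σ i1 ≤ κ * W := by have := H.h13 σ hQσ; rwa [hWσ] at this
  have e2 : W ≤ α * κ * P σ i1 := by have := H.h12 σ hQσ; rwa [hσ2] at this
  -- first time moving index ≤ 1
  obtain ⟨τ, hστ, hcτ, k1, hk1, hk1R⟩ := nsys_max hP hp {i | i ≤ i1} ⟨i1, by simp⟩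
    (le_trans hq hQσ)
  have hQτ : Q ≤ τ := by linarith
  have f1 : P τ i1 = P σ i1 := hcτ τ ⟨hστ, le_rfl⟩ i1 (by simp)
  have hκW : κ * W < α * W := by nlinarith
  obtain ⟨s', hτs', hcs', hs'⟩ := nsys_next hP hp (le_trans hq hQτ) (j := i1) (j' := i2)
    (by omega) hk1R hk1
  have hQs' : Q ≤ s' := by linarith
  have g2 : P s' i2 = P τ i2 := hcs' s' ⟨hτs'.le, le_rfl⟩ i2 (by rw [Fin.lt_def]; omega)
  -- bounds for the third coordinate
  have hup : P τ i2 ≤ κ ^ 2 * W := by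
    have := H.h12 τ hQτ
    rw [f1] at this
    nlinarith
  have hP2up : ∀ t, σ ≤ t → t ≤ s' → P t i2 ≤ κ ^ 2 * W := by
    intro t h1 h2
    rw [← g2] at hup
    exact le_trans (nsys_mono hP i2 (by linarith) h2) hup
  have hP2lo : ∀ t, σ ≤ t → W ≤ P t i2 := by
    intro t h1
    rw [← hσ2]
    exact nsys_mono hP i2 (by linarith) h1
  have hκW3 : κ ^ 2 * W < κ ^ 3 * W := by nlinarith
  have k3 : α * P s' i1 ≤ κ * P s' i3 := H.h13 s' hQs'
  have k3' : α * W ≤ κ * P s' i3 := by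
    have := hP2lo s' (by linarith)
    rw [← hs'] at this
    nlinarith
  have hlt3 : P s' i2 < P s' i3 := by
    have h1 := hP2up s' (by linarith) le_rfl
    have h2 : κ * P s' i2 ≤ κ ^ 3 * W := by nlinarith
    have h3 : κ ^ 3 * W < α * W := by nlinarith
    have h4 : κ * P s' i2 < κ * P s' i3 := by linarith
    exact lt_of_mul_lt_mul_left h4 (by linarith)
  have hup3 : ∀ t, σ ≤ t → t ≤ s' → P t i3 ≤ κ ^ 3 * (α * W) := by
    intro t h1 h2
    have h3 := H.h23 t (by linarith)
    have h4 := hP2up t h1 h2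
    have h5 : α * κ * P t i2 ≤ α * κ * (κ ^ 2 * W) :=
      mul_le_mul_of_nonneg_left h4 (by positivity)
    calc P t i3 ≤ α * κ * (κ ^ 2 * W) := by linarith
      _ = κ ^ 3 * (α * W) := by ring
  have hs'pos := hpos s' hQs' i3
  refine ⟨s', by linarith, ?_, ?_, hup3 s' (by linarith) le_rfl, ?_⟩
  · obtain ⟨k', hk'⟩ := nsys_rt hP (le_trans hq hQs')
    exact ⟨k', nsys_transfer hP (le_trans hq hQτ) hτs' (j := i1) (j' := i2) (j'' := i3)
      (by rw [Fin.le_def]; omega) (by omega) hcs' hlt3 hk', hk'⟩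
  · nlinarith
  · rintro t ⟨ht1, ht2⟩ hE
    rcases le_total t σ with h | h
    · left
      exact hcσ t ⟨ht1, h⟩ i3 (by rw [Fin.lt_def]; omega)
    · right
      refine ⟨?_, hup3 t h ht2⟩
      have hQt : Q ≤ t := by linarith
      have h1 := H.hlo t hQt i3 (by omega)
      rw [v3, hE] at h1
      have h2 := H.h12 t hQt
      have h3 := hP2lo t h
      have h4 := hpos t hQt i3
      have h5 : α * W ≤ κ ^ 2 * P t i3 := by
        have : α * W ≤ α * (α * κ * P t i1) :=
          mul_le_mul_of_nonneg_left (by linarith) (by linarith)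
        have h6 : κ * (α ^ (3 - 1) * P t i1) ≤ κ * (κ * P t i3) :=
          mul_le_mul_of_nonneg_left h1 (by linarith)
        norm_num at h6
        nlinarith
      exact le_trans h5 (mul_le_mul_of_nonneg_right hκ3.le h4.le)

lemma Approx.chain (H : Approx n α κ c Q P i0 i1 i2 i3) (hP : IsNSystem n (Ici q₀) P)
    (hp : IsProper n P) (hq : q₀ ≤ Q) {τ : ℝ} (hτ : Q ≤ τ) {k : Fin n} (hk : Rt P k τ)
    (hk2 : k ≤ i2) {t : ℝ} (ht : τ ≤ t) (hE : P t i0 = P t i1) (N : ℕ) :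
    (∃ m ≤ N, α ^ m * P τ i3 ≤ (κ ^ 3) ^ N * P t i3 ∧ P t i3 ≤ (κ ^ 3) ^ N * (α ^ m * P τ i3)) ∨
    (∃ s, τ ≤ s ∧ s ≤ t ∧ (∃ k', k' ≤ i2 ∧ Rt P k' s) ∧
      α ^ N * P τ i3 ≤ (κ ^ 3) ^ N * P s i3 ∧ P s i3 ≤ (κ ^ 3) ^ N * (α ^ N * P τ i3)) := by
  have hα := H.hα
  have hκ := H.hκ
  have hC : 1 ≤ κ ^ 3 := one_le_pow₀ hκ.le
  have hnn : ∀ q, Q ≤ q → ∀ i, 0 ≤ P q i := fun q hqq i => (hP q (le_trans hq hqq)).1.1 i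
  induction N with
  | zero => right; exact ⟨τ, le_rfl, ht, ⟨k, hk2, hk⟩, by simp, by simp⟩
  | succ N ih =>
    set C := κ ^ 3 with hCdef
    have hCN : 0 < C ^ N := by positivity
    rcases ih with ⟨m, hm, h1, h2⟩ | ⟨s, hs1, hs2, ⟨k', hk', hkR⟩, h1, h2⟩
    · left
      refine ⟨m, by omega, ?_, ?_⟩
      · refine le_trans h1 ?_
        have := hnn t (by linarith) i3
        gcongr
        · omega
      · refine le_trans h2 ?_
        have := hnn τ (by linarith) i3
        gcongr
        · omega
    · obtain ⟨s', hss', hR, e1, e2, e3⟩ := H.step hP hp hq (by linarith : Q ≤ s) hkR hk'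
      rw [← hCdef] at e1 e2 e3
      have key : ∀ y, 0 ≤ y → (α * P s i3 ≤ C * y ∧ y ≤ C * (α * P s i3)) →
          α ^ (N + 1) * P τ i3 ≤ C ^ (N + 1) * y ∧ y ≤ C ^ (N + 1) * (α ^ (N + 1) * P τ i3) := by
        rintro y hy ⟨a1, a2⟩
        constructor
        · calc α ^ (N + 1) * P τ i3 = α * (α ^ N * P τ i3) := by ring
            _ ≤ α * (C ^ N * P s i3) := by gcongr
            _ = C ^ N * (α * P s i3) := by ring
            _ ≤ C ^ N * (C * y) := by gcongr
            _ = _ := by ring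
        · calc y ≤ C * (α * P s i3) := a2
            _ ≤ C * (α * (C ^ N * (α ^ N * P τ i3))) := by gcongr
            _ = _ := by ring
      rcases le_total t s' with h | h
      · left
        rcases e3 t ⟨hs2, h⟩ hE with h3 | h3
        · refine ⟨N, by omega, ?_, ?_⟩
          · rw [h3]
            refine le_trans h1 ?_
            have := hnn s (by linarith) i3
            gcongr
            · omega
          · rw [h3]
            refine le_trans h2 ?_
            have := hnn τ (by linarith) i3
            gcongr
            · omega
        · exact ⟨N + 1, le_rfl, key _ (hnn t (by linarith) i3) h3⟩
      · right
        exact ⟨s', by linarith, h, hR, key _ (hnn s' (by linarith) i3) ⟨e1, e2⟩⟩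

set_option maxHeartbeats 1000000 in
lemma Approx.core (H : Approx n α κ c Q P i0 i1 i2 i3) (hP : IsNSystem n (Ici q₀) P)
    (hp : IsProper n P) (hq : q₀ ≤ Q) (N : ℕ) (hN : (κ ^ 3) ^ N < c ^ 2 * α ^ N) :
    ∃ Q1, ∀ q, Q1 ≤ q → ∃ u, Q ≤ u ∧ P u i0 / u ≤ P q i0 / q ∧ ∃ m ≤ N,
      u ≤ κ ^ (3 * N + 3) * (P u i0 * (1 + α ^ m * ∑ i ∈ Finset.range (n - 1), α ^ i)) ∧
      P u i0 * (1 + α ^ m * ∑ i ∈ Finset.range (n - 1), α ^ i) ≤ κ ^ (3 * N + 3) * u := by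
  have hα := H.hα
  have hκ := H.hκ
  have hc := H.hc
  have v0 := H.v0
  have v1 := H.v1
  have v2 := H.v2
  have v3 := H.v3
  have hpos : ∀ q, Q ≤ q → ∀ i, 0 < P q i := by
    intro q hqq i
    have h1 := H.h0 q hqq
    have h2 := (hP q (le_trans hq hqq)).1.2.1 (show i0 ≤ i by rw [Fin.le_def]; omega)
    have : 0 < c * q := mul_pos H.hc (lt_of_lt_of_le H.hQ hqq)
    linarith
  have hle : ∀ q, Q ≤ q → ∀ i, P q i ≤ q := by
    intro q hqq i
    have h1 := (hP q (le_trans hq hqq)).1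
    calc P q i ≤ ∑ i, P q i := Finset.single_le_sum (fun j _ => h1.1 j) (Finset.mem_univ i)
      _ = q := h1.2.2
  -- general forward move from a time
  have fwd : ∀ t, Q ≤ t → ∃ u t', t ≤ u ∧ u < t' ∧ (∀ y ∈ Icc t u, P y i0 = P t i0) ∧
      (∀ y ∈ Icc u t', ∀ i, i0 < i → P y i = P u i) ∧ P t' i0 = P t' i1 := by
    intro t ht
    obtain ⟨u, htu, hcu, k1, hk1, hk1R⟩ := nsys_max hP hp {i | i ≤ i0} ⟨i0, by simp⟩
      (le_trans hq ht)
    obtain ⟨t', hut', hct', ht'⟩ := nsys_next hP hp (le_trans hq (le_trans ht htu)) (j := i0)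
      (j' := i1) (by omega) hk1R hk1
    exact ⟨u, t', htu, hut', fun y hy => hcu y hy i0 (by simp), hct', ht'⟩
  obtain ⟨_, Q1, hQu, huQ1, _, _, hE1⟩ := fwd Q le_rfl
  refine ⟨Q1, ?_⟩
  intro q hq1
  have hQ1 : Q ≤ Q1 := by linarith
  have hcont : ContinuousOn (fun q => P q i0 - P q i1) (Icc Q1 q) :=
    ((nsys_cont hP i0).sub (nsys_cont hP i1)).mono (fun x hx => by
      have := hx.1; simp only [mem_Ici]; linarith)
  have hcl : IsClosed (Icc Q1 q ∩ (fun q => P q i0 - P q i1) ⁻¹' {0}) :=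
    hcont.preimage_isClosed_of_isClosed isClosed_Icc isClosed_singleton
  set X := Icc Q1 q ∩ (fun q => P q i0 - P q i1) ⁻¹' {0} with hX
  have hXne : X.Nonempty := ⟨Q1, ⟨le_rfl, hq1⟩, by simp [hE1]⟩
  have hXb : BddAbove X := ⟨q, fun x hx => hx.1.2⟩
  have htX := hcl.csSup_mem hXne hXb
  set t := sSup X with htdef
  have htQ1 : Q1 ≤ t := htX.1.1
  have htq : t ≤ q := htX.1.2
  have hEt : P t i0 = P t i1 := by
    have := htX.2
    simp only [mem_preimage, mem_singleton_iff] at this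
    linarith
  obtain ⟨τ, htτ, hcτ, k, hk2, hkR⟩ := nsys_max hP hp {i | i ≤ i2} ⟨i2, by simp⟩
    (show q₀ ≤ t by linarith)
  have hQτ : Q ≤ τ := by linarith
  obtain ⟨u, t', hτu, hut', hcu, hct', hEt'⟩ := fwd τ hQτ
  have hqt' : q ≤ t' := by
    by_contra hcon
    push Not at hcon
    have : t' ∈ X := ⟨⟨by linarith, hcon.le⟩, by simp [hEt']⟩
    have := le_csSup hXb this
    linarith
  have hQu' : Q ≤ u := by linarith
  have hQt' : Q ≤ t' := by linarith
  have hQpos := H.hQ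
  have h0τ : P τ i0 = P t i0 := hcτ τ ⟨htτ, le_rfl⟩ i0 (by rw [mem_ofPred_eq, Fin.le_def]; omega)
  have h1τ : P τ i1 = P t i1 := hcτ τ ⟨htτ, le_rfl⟩ i1 (by rw [mem_ofPred_eq, Fin.le_def]; omega)
  set A := P τ i0 with hA
  have hA1 : P τ i1 = A := by rw [h1τ, h0τ, hEt]
  have hu0 : P u i0 = A := hcu u ⟨hτu, le_rfl⟩
  have hApos : 0 < A := hpos τ hQτ i0
  refine ⟨u, hQu', ?_, ?_⟩
  · rw [hu0]
    have hupos : 0 < u := by linarith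
    have hqpos : 0 < q := by linarith
    rw [div_le_div_iff₀ hupos hqpos]
    rcases le_total q u with h | h
    · have : P q i0 = A := by
        rcases le_total q τ with h' | h'
        · rw [hcτ q ⟨htq, h'⟩ i0 (by rw [mem_ofPred_eq, Fin.le_def]; omega), h0τ]
        · exact hcu q ⟨h', h⟩
      rw [this]
      gcongr
    · have hs1 := (hP q (by simp only [mem_Ici]; linarith)).1.2.2
      have hs2 := (hP u (by simp only [mem_Ici]; linarith)).1.2.2
      have hq0 : P q i0 = A + (q - u) := by
        rw [← Finset.add_sum_erase _ _ (Finset.mem_univ i0)] at hs1 hs2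
        have : ∑ x ∈ Finset.univ.erase i0, P q x = ∑ x ∈ Finset.univ.erase i0, P u x := by
          apply Finset.sum_congr rfl
          intro x hx
          refine hct' q ⟨h, hqt'⟩ x ?_
          have := (Finset.mem_erase.mp hx).1
          rw [Fin.lt_def]
          have h3 : (x : ℕ) ≠ i0 := fun h => this (Fin.ext h)
          omega
        rw [hu0] at hs2
        linarith
      rw [hq0]
      have := hle u hQu' i0
      rw [hu0] at this
      nlinarith
  · -- v/A
    set v := P t' i1 with hv
    have hvu : P u i1 = v := (hct' t' ⟨hut'.le, le_rfl⟩ i1 (by rw [Fin.lt_def]; omega)).symm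
    have hvpos : 0 < v := hpos t' hQt' i1
    have hWpos : 0 < P τ i3 := hpos τ hQτ i3
    have hAW : A ≤ P τ i3 := (hP τ (le_trans hq hQτ)).1.2.1 (by rw [Fin.le_def]; omega)
    rcases H.chain hP hp hq hQτ hkR hk2 (by linarith : τ ≤ t') hEt' N with
      ⟨m, hm, m1, m2⟩ | ⟨s, hs1, hs2, _, m1, _⟩
    · refine ⟨m, hm, ?_⟩
      have w1 := H.hhi τ hQτ i3 (by omega)
      have w2 := H.hlo τ hQτ i3 (by omega)
      have w3 := H.hhi t' hQt' i3 (by omega)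
      have w4 := H.hlo t' hQt' i3 (by omega)
      rw [v3] at w1 w2 w3 w4
      norm_num at w1 w2 w3 w4
      rw [hA1] at w1
      rw [← hA] at w2
      rw [← hv] at w3
      rw [hEt'] at w4
      have hC : 0 < (κ ^ 3) ^ N := by positivity
      have vA : v ≤ κ ^ 2 * (κ ^ 3) ^ N * (α ^ m * A) := by
        have : α ^ 2 * v ≤ α ^ 2 * (κ ^ 2 * (κ ^ 3) ^ N * (α ^ m * A)) := by
          calc α ^ 2 * v ≤ κ * P t' i3 := w4
            _ ≤ κ * ((κ ^ 3) ^ N * (α ^ m * P τ i3)) := by gcongr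
            _ ≤ κ * ((κ ^ 3) ^ N * (α ^ m * (κ * α ^ 2 * A))) := by gcongr
            _ = _ := by ring
        exact le_of_mul_le_mul_left this (by positivity)
      have Av : α ^ m * A ≤ κ ^ 2 * (κ ^ 3) ^ N * v := by
        have : α ^ 2 * (α ^ m * A) ≤ α ^ 2 * (κ ^ 2 * (κ ^ 3) ^ N * v) := by
          calc α ^ 2 * (α ^ m * A) = α ^ m * (α ^ 2 * A) := by ring
            _ ≤ α ^ m * (κ * P τ i3) := by gcongr
            _ = κ * (α ^ m * P τ i3) := by ring
            _ ≤ κ * ((κ ^ 3) ^ N * P t' i3) := by gcongr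
            _ ≤ κ * ((κ ^ 3) ^ N * (κ * α ^ 2 * v)) := by gcongr
            _ = _ := by ring
        exact le_of_mul_le_mul_left this (by positivity)
      have hs2 := (hP u (by simp only [mem_Ici]; linarith)).1.2.2
      have hK : 1 ≤ κ ^ (3 * N + 3) := one_le_pow₀ hκ.le
      have hKe : κ ^ (3 * N + 3) = κ * (κ ^ 2 * (κ ^ 3) ^ N) := by rw [← pow_mul]; ring
      rw [← sum_weights n (by omega), hu0]
      have term : ∀ i : Fin n,
          P u i ≤ κ ^ (3 * N + 3) * (A * (if (i : ℕ) = 0 then 1 else α ^ m * α ^ ((i : ℕ) - 1))) ∧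
          A * (if (i : ℕ) = 0 then 1 else α ^ m * α ^ ((i : ℕ) - 1)) ≤ κ ^ (3 * N + 3) * P u i := by
        intro i
        by_cases hi : (i : ℕ) = 0
        · have : i = i0 := Fin.ext (by omega)
          subst this
          simp only [hi, if_true, hu0]
          have := le_mul_of_one_le_left hApos.le hK
          constructor <;> linarith
        · simp only [hi, if_false]
          have hi1 : 1 ≤ (i : ℕ) := by omega
          have hPi : P t' i = P u i := hct' t' ⟨hut'.le, le_rfl⟩ i (by rw [Fin.lt_def]; omega)
          have y1 := H.hhi t' hQt' i hi1
          have y2 := H.hlo t' hQt' i hi1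
          rw [hPi, ← hv] at y1
          rw [hPi, hEt'] at y2
          constructor
          · calc P u i ≤ κ * α ^ ((i : ℕ) - 1) * v := y1
              _ ≤ κ * α ^ ((i : ℕ) - 1) * (κ ^ 2 * (κ ^ 3) ^ N * (α ^ m * A)) := by gcongr
              _ = _ := by rw [hKe]; ring
          · calc A * (α ^ m * α ^ ((i : ℕ) - 1)) = α ^ ((i : ℕ) - 1) * (α ^ m * A) := by ring
              _ ≤ α ^ ((i : ℕ) - 1) * (κ ^ 2 * (κ ^ 3) ^ N * v) := by gcongr
              _ = κ ^ 2 * (κ ^ 3) ^ N * (α ^ ((i : ℕ) - 1) * v) := by ring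
              _ ≤ κ ^ 2 * (κ ^ 3) ^ N * (κ * P u i) := by gcongr
              _ = _ := by rw [hKe]; ring
      rw [Finset.mul_sum, Finset.mul_sum]
      constructor
      · calc u = ∑ i, P u i := hs2.symm
          _ ≤ _ := Finset.sum_le_sum (fun i _ => (term i).1)
      · calc _ ≤ ∑ i, κ ^ (3 * N + 3) * P u i := Finset.sum_le_sum (fun i _ => (term i).2)
          _ = _ := by rw [← Finset.mul_sum, hs2]
    · exfalso
      have a1 : P s i3 ≤ t' := le_trans (hle s (by linarith) i3) hs2
      have a2 : c * t' ≤ v := by have := H.h0 t' hQt'; rwa [hEt'] at this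
      have a3 : v ≤ u := by rw [← hvu]; exact hle u hQu' i1
      have a4 : c * u ≤ A := by have := H.h0 u hQu'; rwa [hu0] at this
      have a5 : c ^ 2 * P s i3 ≤ A := by
        calc c ^ 2 * P s i3 ≤ c ^ 2 * t' := by gcongr
          _ = c * (c * t') := by ring
          _ ≤ c * u := by gcongr; linarith
          _ ≤ A := a4
      have hC : 0 < (κ ^ 3) ^ N := by positivity
      have a6 : c ^ 2 * (α ^ N * A) ≤ (κ ^ 3) ^ N * A := by
        calc c ^ 2 * (α ^ N * A) ≤ c ^ 2 * (α ^ N * P τ i3) := by gcongr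
          _ ≤ c ^ 2 * ((κ ^ 3) ^ N * P s i3) := by gcongr
          _ = (κ ^ 3) ^ N * (c ^ 2 * P s i3) := by ring
          _ ≤ _ := by gcongr
      have a7 := mul_lt_mul_of_pos_right hN hApos
      linarith

/-- `P_2 = P_3` happens at arbitrarily large times. -/
lemma nsys_meet (hP : IsNSystem n (Ici q₀) P) (hp : IsProper n P) (j j' : Fin n)
    (hj : (j' : ℕ) = j + 1) {s : ℝ} (hs : q₀ ≤ s) : ∃ σ, s ≤ σ ∧ P σ j = P σ j' := by
  obtain ⟨u, htu, hcu, k1, hk1, hk1R⟩ := nsys_max hP hp {i | i ≤ j} ⟨j, by simp⟩ hs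
  obtain ⟨t', hut', hct', ht'⟩ := nsys_next hP hp (le_trans hs htu) (j := j)
      (j' := j') hj hk1R hk1
  exact ⟨t', by linarith, ht'⟩

end core

lemma pure_ineq (n : ℕ) (hn : 4 ≤ n) (α ρ κ : ℝ) (hα : 1 < α) (hρ : 1 < ρ) (hκ : ρ ^ n ≤ κ)
    (x : ℕ → ℝ) (hx : ∀ j, 0 ≤ x j)
    (hst : ∀ j, 1 ≤ j → j ≤ n - 2 → x (j + 1) ≤ α * ρ * x j)
    (hb : α ^ (n - 3) * x 1 ≤ ρ * x (n - 1)) (hc : α ^ (n - 2) * x 0 ≤ ρ * x (n - 1)) :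
    (α * x 1 ≤ κ * x 3) ∧
    (∀ j, 1 ≤ j → j ≤ n - 1 → α ^ (j - 1) * x 0 ≤ κ * x j) ∧
    (∀ j, 1 ≤ j → j ≤ n - 1 → x j ≤ κ * α ^ (j - 1) * x 1) := by
  have gen : ∀ d j, 1 ≤ j → j + d ≤ n - 1 → x (j + d) ≤ (α * ρ) ^ d * x j := by
    intro d
    induction d with
    | zero => intro j _ _; simp
    | succ d ih =>
      intro j h1 h2
      have e1 := ih j h1 (by omega)
      have e2 := hst (j + d) (by omega) (by omega)
      calc x (j + (d + 1)) ≤ α * ρ * x (j + d) := e2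
        _ ≤ α * ρ * ((α * ρ) ^ d * x j) := by gcongr
        _ = _ := by ring
  have hρκ : ∀ d, d ≤ n → ρ ^ d ≤ κ := fun d hd => le_trans (pow_le_pow_right₀ hρ.le hd) hκ
  refine ⟨?_, ?_, ?_⟩
  · have e := gen (n - 4) 3 (by omega) (by omega)
    rw [show 3 + (n - 4) = n - 1 by omega] at e
    have h3 : n - 3 = (n - 4) + 1 := by omega
    have : α ^ (n - 4) * (α * x 1) ≤ α ^ (n - 4) * (κ * x 3) := by
      calc α ^ (n - 4) * (α * x 1) = α ^ (n - 3) * x 1 := by rw [h3]; ring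
        _ ≤ ρ * x (n - 1) := hb
        _ ≤ ρ * ((α * ρ) ^ (n - 4) * x 3) := by gcongr
        _ = α ^ (n - 4) * (ρ ^ (n - 4 + 1) * x 3) := by rw [mul_pow]; ring
        _ ≤ α ^ (n - 4) * (κ * x 3) := by
          have := hx 3
          have := hρκ (n - 4 + 1) (by omega)
          gcongr
    exact le_of_mul_le_mul_left this (by positivity)
  · intro j h1 h2
    have e := gen (n - 1 - j) j h1 (by omega)
    rw [show j + (n - 1 - j) = n - 1 by omega] at e
    have h3 : n - 2 = (n - 1 - j) + (j - 1) := by omega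
    have : α ^ (n - 1 - j) * (α ^ (j - 1) * x 0) ≤ α ^ (n - 1 - j) * (κ * x j) := by
      calc α ^ (n - 1 - j) * (α ^ (j - 1) * x 0) = α ^ (n - 2) * x 0 := by rw [h3, pow_add]; ring
        _ ≤ ρ * x (n - 1) := hc
        _ ≤ ρ * ((α * ρ) ^ (n - 1 - j) * x j) := by gcongr
        _ = α ^ (n - 1 - j) * (ρ ^ (n - 1 - j + 1) * x j) := by rw [mul_pow]; ring
        _ ≤ α ^ (n - 1 - j) * (κ * x j) := by
          have := hx j
          have := hρκ (n - 1 - j + 1) (by omega)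
          gcongr
    exact le_of_mul_le_mul_left this (by positivity)
  · intro j h1 h2
    have e := gen (j - 1) 1 le_rfl (by omega)
    rw [show 1 + (j - 1) = j by omega] at e
    have := hx 1
    have := hρκ (j - 1) (by omega)
    calc x j ≤ (α * ρ) ^ (j - 1) * x 1 := e
      _ = ρ ^ (j - 1) * α ^ (j - 1) * x 1 := by rw [mul_pow]; ring
      _ ≤ _ := by gcongr

lemma T_bound (n : ℕ) (hn : 4 ≤ n) (α : ℝ) (hα : 1 < α) (x : Fin n → ℝ) (q : ℝ) (hq : 0 < q)
    (hx : ∀ i, 0 ≤ x i ∧ x i ≤ q) (j : Fin (n + 1)) :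
    |Tbig n hn α x j / q| ≤ α ^ n + 1 := by
  rw [abs_div, abs_of_pos hq, div_le_iff₀ hq]
  have key : ∀ (d e : ℕ) (i k : Fin n), d ≤ n → e ≤ n → |α ^ d * x i - α ^ e * x k| ≤ (α ^ n + 1) * q := by
    intro d e i k hd he
    have h1 : α ^ d ≤ α ^ n := pow_le_pow_right₀ hα.le hd
    have h2 : α ^ e ≤ α ^ n := pow_le_pow_right₀ hα.le he
    have h3 := hx i
    have h4 := hx k
    have h5 : α ^ d * x i ≤ α ^ n * q := mul_le_mul h1 h3.2 h3.1 (by positivity)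
    have h6 : α ^ e * x k ≤ α ^ n * q := mul_le_mul h2 h4.2 h4.1 (by positivity)
    have h7 : 0 ≤ α ^ d * x i := mul_nonneg (by positivity) h3.1
    have h8 : 0 ≤ α ^ e * x k := mul_nonneg (by positivity) h4.1
    rw [abs_le]
    constructor <;> nlinarith
  unfold Tbig
  split_ifs
  · rw [abs_of_nonneg (hx _).1]
    have := (hx ⟨0, by omega⟩).2
    have : 0 ≤ α ^ n * q := by positivity
    linarith
  · have := key 1 0 ⟨(j : ℕ), by omega⟩ ⟨(j : ℕ) + 1, by omega⟩ (by omega) (by omega)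
    simpa using this
  · have := key 0 (n - 3) ⟨n - 1, by omega⟩ ⟨1, by omega⟩ (by omega) (by omega)
    simpa using this
  · have := key 0 (n - 2) ⟨n - 1, by omega⟩ ⟨0, by omega⟩ (by omega) (by omega)
    simpa using this

lemma T_bound_ev (n : ℕ) (hn : 4 ≤ n) (α : ℝ) (hα : 1 < α) {q₀ : ℝ} {P : ℝ → Fin n → ℝ}
    (hP : IsNSystem n (Ici q₀) P) (j : Fin (n + 1)) :
    ∀ᶠ q in atTop, |Tbig n hn α (P q) j / q| ≤ α ^ n + 1 := by
  filter_upwards [eventually_ge_atTop q₀, eventually_gt_atTop 0] with q h1 h2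
  have h := (hP q h1).1
  refine T_bound n hn α hα (P q) q h2 (fun i => ⟨h.1 i, ?_⟩) j
  calc P q i ≤ ∑ i, P q i := Finset.single_le_sum (fun j _ => h.1 j) (Finset.mem_univ i)
      _ = q := h.2.2

lemma bdd_of_abs {u : ℝ → ℝ} {C : ℝ} (h : ∀ᶠ q in atTop, |u q| ≤ C) :
    IsBoundedUnder (· ≥ ·) atTop u ∧ IsCoboundedUnder (· ≥ ·) atTop u := by
  constructor
  · exact ⟨-C, by
      simp only [eventually_map]
      filter_upwards [h] with q hq using (abs_le.mp hq).1⟩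
  · apply IsBoundedUnder.isCoboundedUnder_ge
    exact ⟨C, by
      simp only [eventually_map]
      filter_upwards [h] with q hq using (abs_le.mp hq).2⟩

lemma liminf_eq_of {u : ℝ → ℝ} {C L : ℝ} (h : ∀ᶠ q in atTop, |u q| ≤ C)
    (h1 : ∀ᶠ q in atTop, L ≤ u q) (h2 : ∀ ε > 0, ∃ᶠ q in atTop, u q ≤ L + ε) :
    liminf u atTop = L := by
  obtain ⟨hb, hc⟩ := bdd_of_abs h
  apply le_antisymm
  · apply le_of_forall_pos_le_add
    intro ε hε
    exact liminf_le_of_frequently_le (h2 ε hε) hb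
  · exact le_liminf_of_le hc h1

lemma exists_approx (n : ℕ) (hn : 4 ≤ n) (α : ℝ) (hα : 1 < α) {q₀ θ : ℝ} (hθ : 0 < θ)
    {P : ℝ → Fin n → ℝ} (hP : IsNSystem n (Ici q₀) P)
    (hmu : muVec (Tbig n hn α) P = fun j : Fin (n + 1) => if (j : ℕ) = 0 then θ else 0)
    (κ : ℝ) (hκ : 1 < κ) (hκα : κ ^ 3 < α) (δ : ℝ) (hδ : 0 < δ) :
    ∃ Q, q₀ ≤ Q ∧ Approx n α κ (θ / 2) Q P ⟨0, by omega⟩ ⟨1, by omega⟩ ⟨2, by omega⟩ ⟨3, by omega⟩ ∧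
      ∀ q, Q ≤ q → θ - δ ≤ P q ⟨0, by omega⟩ / q := by
  obtain ⟨ρ, hρ, hρκ⟩ : ∃ ρ : ℝ, 1 < ρ ∧ ρ ^ n ≤ κ := by
    refine ⟨κ ^ ((n : ℝ)⁻¹), Real.one_lt_rpow hκ (by positivity), ?_⟩
    rw [Real.rpow_inv_natCast_pow (by linarith) (by omega)]
  set ε := θ / 2 * (ρ - 1) with hε
  have hεpos : 0 < ε := by apply mul_pos <;> linarith
  have hT : ∀ j : Fin (n + 1), (j : ℕ) ≠ 0 → ∀ᶠ q in atTop, -ε < Tbig n hn α (P q) j / q := by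
    intro j hj
    have h1 := congrFun hmu j
    simp only [hj, if_false, muVec] at h1
    exact eventually_lt_of_lt_liminf (by rw [h1]; linarith) (bdd_of_abs (T_bound_ev n hn α hα hP j)).1
  have hTall : ∀ᶠ q in atTop, ∀ j : Fin (n + 1), (j : ℕ) ≠ 0 → -ε < Tbig n hn α (P q) j / q := by
    rw [eventually_all]
    intro j
    by_cases hj : (j : ℕ) = 0
    · simp [hj]
    · filter_upwards [hT j hj] with q hq _ using hq
  have hT0 : ∀ d, 0 < d → ∀ᶠ q in atTop, θ - d < P q ⟨0, by omega⟩ / q := by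
    intro d hd
    have h1 := congrFun hmu ⟨0, by omega⟩
    simp only [muVec, if_true] at h1
    have := eventually_lt_of_lt_liminf (b := θ - d) (by rw [h1]; linarith)
      (bdd_of_abs (T_bound_ev n hn α hα hP ⟨0, by omega⟩)).1
    simpa [Tbig] using this
  obtain ⟨Q, hQ⟩ := eventually_atTop.mp (hTall.and ((hT0 δ hδ).and ((hT0 (θ / 2) (by linarith)).and
    ((eventually_ge_atTop q₀).and (eventually_gt_atTop 0)))))
  have hQpos : 0 < Q := (hQ Q le_rfl).2.2.2.2
  have hqQ : q₀ ≤ Q := (hQ Q le_rfl).2.2.2.1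
  have main : ∀ q, Q ≤ q → θ / 2 * q ≤ P q ⟨0, by omega⟩ ∧
    P q ⟨2, by omega⟩ ≤ α * κ * P q ⟨1, by omega⟩ ∧
    P q ⟨3, by omega⟩ ≤ α * κ * P q ⟨2, by omega⟩ ∧
    α * P q ⟨1, by omega⟩ ≤ κ * P q ⟨3, by omega⟩ ∧
    (∀ j : Fin n, 1 ≤ (j : ℕ) → α ^ ((j : ℕ) - 1) * P q ⟨0, by omega⟩ ≤ κ * P q j) ∧
    (∀ j : Fin n, 1 ≤ (j : ℕ) → P q j ≤ κ * α ^ ((j : ℕ) - 1) * P q ⟨1, by omega⟩) := by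
    intro q hqQ'
    obtain ⟨hTq, _, h0, hqq, hqpos⟩ := hQ q hqQ'
    have hsys := (hP q hqq).1
    have h0' : θ / 2 * q ≤ P q ⟨0, by omega⟩ := by
      rw [lt_div_iff₀ hqpos] at h0
      linarith
    have hlow : ∀ i, ε * q ≤ (ρ - 1) * P q i := by
      intro i
      have : P q ⟨0, by omega⟩ ≤ P q i := hsys.2.1 (by rw [Fin.le_def]; simp)
      calc ε * q = (ρ - 1) * (θ / 2 * q) := by rw [hε]; ring
        _ ≤ (ρ - 1) * P q i := by
          apply mul_le_mul_of_nonneg_left _ (by linarith)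
          linarith
    have hTq' : ∀ j : Fin (n + 1), (j : ℕ) ≠ 0 → -(ε * q) ≤ Tbig n hn α (P q) j := by
      intro j hj
      have := hTq j hj
      rw [lt_div_iff₀ hqpos] at this
      linarith
    set x : ℕ → ℝ := fun j => if h : j < n then P q ⟨j, h⟩ else 0 with hx
    have hxe : ∀ j (h : j < n), x j = P q ⟨j, h⟩ := by
      intro j h; simp [hx, h]
    have hst : ∀ j, 1 ≤ j → j ≤ n - 2 → x (j + 1) ≤ α * ρ * x j := by
      intro j h1 h2
      have := hTq' ⟨j, by omega⟩ (by simp; omega)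
      unfold Tbig at this
      rw [if_neg (by simp; omega), dif_pos (by simpa using h2)] at this
      simp only at this
      rw [hxe j (by omega), hxe (j + 1) (by omega)]
      have h3 := hlow ⟨j, by omega⟩
      have h4 := hsys.1 ⟨j, by omega⟩
      have h5 : (ρ - 1) * P q ⟨j, by omega⟩ ≤ α * ((ρ - 1) * P q ⟨j, by omega⟩) := by
        apply le_mul_of_one_le_left _ hα.le
        apply mul_nonneg (by linarith) h4
      linarith
    have hb : α ^ (n - 3) * x 1 ≤ ρ * x (n - 1) := by
      have := hTq' ⟨n - 1, by omega⟩ (by simp; omega)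
      unfold Tbig at this
      rw [if_neg (by simp; omega), dif_neg (by simp; omega), if_pos (by simp)] at this
      rw [hxe 1 (by omega), hxe (n - 1) (by omega)]
      have h3 := hlow ⟨n - 1, by omega⟩
      linarith
    have hc : α ^ (n - 2) * x 0 ≤ ρ * x (n - 1) := by
      have := hTq' ⟨n, by omega⟩ (by simp; omega)
      unfold Tbig at this
      rw [if_neg (by simp; omega), dif_neg (by simp; omega), if_neg (by simp; omega)] at this
      rw [hxe 0 (by omega), hxe (n - 1) (by omega)]
      have h3 := hlow ⟨n - 1, by omega⟩
      linarith
    have hx0 : ∀ j, 0 ≤ x j := by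
      intro j
      simp only [hx]
      split_ifs
      · exact hsys.1 _
      · exact le_rfl
    have hρκ1 : ρ ≤ κ := le_trans (le_self_pow₀ hρ.le (by omega)) hρκ
    obtain ⟨p1, p2, p3⟩ := pure_ineq n hn α ρ κ hα hρ hρκ x hx0 hst hb hc
    have up : ∀ j, 1 ≤ j → j ≤ n - 2 → x (j + 1) ≤ α * κ * x j := by
      intro j h1 h2
      refine le_trans (hst j h1 h2) ?_
      have := hx0 j
      gcongr
    refine ⟨h0', ?_, ?_, ?_, ?_, ?_⟩
    · have := up 1 le_rfl (by omega)
      rwa [hxe 1 (by omega), hxe (1 + 1) (by omega)] at this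
    · have := up 2 (by omega) (by omega)
      rwa [hxe 2 (by omega), hxe (2 + 1) (by omega)] at this
    · rwa [hxe 1 (by omega), hxe 3 (by omega)] at p1
    · intro j hj
      have := p2 j hj (by omega)
      rwa [hxe 0 (by omega), hxe j j.2] at this
    · intro j hj
      have := p3 j hj (by omega)
      rwa [hxe 1 (by omega), hxe j j.2] at this
  refine ⟨Q, hqQ, ?_, fun q hq => (hQ q hq).2.1.le⟩
  exact { v0 := rfl, v1 := rfl, v2 := rfl, v3 := rfl, hα := hα, hκ := hκ, hκα := hκα,
          hc := by linarith, hQ := hQpos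
          h0 := fun q hq => (main q hq).1
          h12 := fun q hq => (main q hq).2.1
          h23 := fun q hq => (main q hq).2.2.1
          h13 := fun q hq => (main q hq).2.2.2.1
          hlo := fun q hq => (main q hq).2.2.2.2.1
          hhi := fun q hq => (main q hq).2.2.2.2.2 }

lemma exists_kappa (N : ℕ) (b₁ b₂ b₃ b₄ : ℝ) (h1 : 1 < b₁) (h2 : 1 < b₂) (h3 : 1 < b₃)
    (h4 : 1 < b₄) :
    ∃ κ : ℝ, 1 < κ ∧ κ ^ 3 < b₁ ∧ (κ ^ 3) ^ N < b₂ ∧ κ ^ (3 * N + 3) < b₃ ∧ κ ^ 2 < b₄ := by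
  have key : ∀ (f : ℝ → ℝ) (b : ℝ), Continuous f → f 1 = 1 → 1 < b →
      ∀ᶠ κ in nhdsWithin (1 : ℝ) (Ioi 1), f κ < b := by
    intro f b hf h hb
    apply eventually_nhdsWithin_of_eventually_nhds
    apply hf.continuousAt.eventually_lt_const
    rwa [h]
  have e := (key (fun κ => κ ^ 3) b₁ (by fun_prop) (by simp) h1).and
    ((key (fun κ => (κ ^ 3) ^ N) b₂ (by fun_prop) (by simp) h2).and
    ((key (fun κ => κ ^ (3 * N + 3)) b₃ (by fun_prop) (by simp) h3).and
    ((key (fun κ => κ ^ 2) b₄ (by fun_prop) (by simp) h4).and self_mem_nhdsWithin)))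
  obtain ⟨κ, a1, a2, a3, a4, a5⟩ := e.exists
  exact ⟨κ, a5, a1, a2, a3, a4⟩

lemma forward (n : ℕ) (hn : 4 ≤ n) (α : ℝ) (hα : 1 < α) {q₀ θ : ℝ} (hθ : 0 < θ)
    {P : ℝ → Fin n → ℝ} (hP : IsNSystem n (Ici q₀) P) (hp : IsProper n P)
    (hmu : muVec (Tbig n hn α) P = fun j : Fin (n + 1) => if (j : ℕ) = 0 then θ else 0) :
    ∃ m : ℕ, 0 < m ∧ θ = (1 + α ^ m * ∑ i ∈ Finset.range (n - 1), α ^ i)⁻¹ := by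
  set β := ∑ i ∈ Finset.range (n - 1), α ^ i with hβ
  have hβpos : 0 < β := by
    apply Finset.sum_pos
    · intro i _; positivity
    · simp; omega
  obtain ⟨N, hN⟩ : ∃ N : ℕ, 1 / (θ / 2) ^ 2 < α ^ N := pow_unbounded_of_one_lt _ hα
  rw [div_lt_iff₀ (by positivity), mul_comm] at hN
  set f : ℕ → ℝ := fun m => (1 + α ^ m * β)⁻¹ with hf
  have hmem : θ ∈ f '' (Set.Iic N) := by
    have hfin : (f '' (Set.Iic N)).Finite := (Set.finite_Iic N).image f
    rw [← hfin.isClosed.closure_eq, Metric.mem_closure_iff]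
    intro δ hδ
    obtain ⟨κ, k1, k2, k3, k4, _⟩ := exists_kappa N α ((θ / 2) ^ 2 * α ^ N) (1 + δ / 3) 2 hα hN
      (by linarith) (by norm_num)
    obtain ⟨Q, hqQ, H, hlow⟩ := exists_approx n hn α hα hθ hP hmu κ k1 k2 (δ / 3) (by linarith)
    obtain ⟨Q1, hQ1⟩ := H.core hP hp hqQ N k3
    have hfr : ∃ᶠ q in atTop, P q ⟨0, by omega⟩ / q < θ + δ / 3 := by
      have h1 := congrFun hmu ⟨0, by omega⟩
      simp only [muVec, if_true] at h1
      have := frequently_lt_of_liminf_lt (b := θ + δ / 3)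
        (bdd_of_abs (T_bound_ev n hn α hα hP ⟨0, by omega⟩)).2 (by rw [h1]; linarith)
      simpa [Tbig] using this
    obtain ⟨q, hq, hqQ1⟩ := (hfr.and_eventually (eventually_ge_atTop Q1)).exists
    obtain ⟨u, hu, hux, m, hm, a1, a2⟩ := hQ1 q hqQ1
    refine ⟨f m, ⟨m, hm, rfl⟩, ?_⟩
    have hupos : 0 < u := lt_of_lt_of_le H.hQ hu
    have hl := hlow u hu
    set K := κ ^ (3 * N + 3) with hK
    set D := 1 + α ^ m * β with hD
    have hDpos : 1 < D := by
      have : 0 < α ^ m * β := by positivity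
      linarith
    have hK1 : 1 ≤ K := one_le_pow₀ k1.le
    have hsys := (hP u (le_trans hqQ hu)).1
    set A := P u ⟨0, by omega⟩ with hA
    have hAu : A ≤ u := by
      calc A ≤ ∑ i, P u i := Finset.single_le_sum (fun j _ => hsys.1 j) (Finset.mem_univ _)
        _ = u := hsys.2.2
    have hA0 : 0 ≤ A := hsys.1 _
    have hx1 : A / u ≤ 1 := (div_le_one hupos).mpr hAu
    have hx0 : 0 ≤ A / u := by positivity
    have hf1 : f m ≤ 1 := inv_le_one_of_one_le₀ hDpos.le
    have hf0 : 0 ≤ f m := by simp only [hf]; positivity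
    have b1 : f m ≤ K * (A / u) := by
      have : f m = 1 / D := by simp [hf, hD]
      rw [this, div_le_iff₀ (by linarith)]
      rw [show K * (A / u) * D = K * (A * D) / u by ring, le_div_iff₀ hupos]
      linarith
    have b2 : A / u ≤ K * f m := by
      have : f m = 1 / D := by simp [hf, hD]
      rw [this, div_le_iff₀ hupos, show K * (1 / D) * u = K * u / D by ring, le_div_iff₀ (by linarith)]
      linarith
    rw [Real.dist_eq, abs_lt]
    constructor <;> nlinarith
  obtain ⟨m, _, hm⟩ := hmem
  refine ⟨m, ?_, hm.symm⟩
  rcases Nat.eq_zero_or_pos m with rfl | h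
  · exfalso
    simp only [hf, pow_zero, one_mul] at hm
    have hgt : 1 < θ * (α + β) := by
      rw [← hm, inv_mul_eq_div, lt_div_iff₀ (by linarith)]
      linarith
    obtain ⟨κ, k1, k2, _, _, k5⟩ := exists_kappa 0 α 2 2 (θ * (α + β)) hα (by norm_num)
      (by norm_num) hgt
    have hκinv : κ⁻¹ < 1 := inv_lt_one_of_one_lt₀ k1
    obtain ⟨Q, hqQ, H, hlow⟩ := exists_approx n hn α hα hθ hP hmu κ k1 k2 (θ - θ * κ⁻¹) (by nlinarith)
    obtain ⟨σ, hσ, hE⟩ := nsys_meet hP hp ⟨1, by omega⟩ ⟨2, by omega⟩ (by simp) hqQ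
    have hσpos : 0 < σ := lt_of_lt_of_le H.hQ hσ
    have hl := hlow σ hσ
    rw [sub_sub_cancel, le_div_iff₀ hσpos] at hl
    have hsys := (hP σ (le_trans hqQ hσ)).1
    have hlo := H.hlo σ hσ
    set A := P σ ⟨0, by omega⟩ with hA
    have hA0 : 0 ≤ A := hsys.1 _
    have hsum : A * (1 + β) + A * (α - 1) ≤ κ * σ := by
      have hw := sum_weights n (by omega) α 1
      rw [one_mul, ← hβ] at hw
      rw [← hw, ← hsys.2.2, Finset.mul_sum, Finset.mul_sum]
      have : A * (α - 1) = ∑ i : Fin n, if i = ⟨1, by omega⟩ then A * (α - 1) else 0 := by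
        rw [Finset.sum_ite_eq' Finset.univ]; simp
      rw [this, ← Finset.sum_add_distrib]
      apply Finset.sum_le_sum
      have h0n : 0 < n := by omega
      have h1n : 1 < n := by omega
      intro i _
      by_cases hi0 : (i : ℕ) = 0
      · have : i = ⟨0, h0n⟩ := Fin.ext hi0
        subst this
        simp
        nlinarith
      · by_cases hi1 : (i : ℕ) = 1
        · have : i = ⟨1, h1n⟩ := Fin.ext hi1
          subst this
          have h2 := hlo ⟨2, by omega⟩ (by simp)
          rw [hE]
          simp at h2 ⊢
          linarith
        · have hne : i ≠ ⟨1, by omega⟩ := fun h => hi1 (by rw [h])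
          have := hlo i (by omega)
          simp only [hi0, if_false, hne]
          linarith
    have h3 : θ * κ⁻¹ * σ * (α + β) ≤ κ * σ := by
      calc θ * κ⁻¹ * σ * (α + β) ≤ A * (α + β) := by gcongr
        _ ≤ κ * σ := by linarith
    have h4 : θ * (α + β) * σ ≤ κ ^ 2 * σ := by
      have : κ * (θ * κ⁻¹ * σ * (α + β)) ≤ κ * (κ * σ) := by gcongr
      have e : κ * (θ * κ⁻¹ * σ * (α + β)) = θ * (α + β) * σ := by
        field_simp
      rw [e] at this
      linarith
    have := le_of_mul_le_mul_right h4 hσpos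
    linarith
  · exact h

lemma theta_nonneg (n : ℕ) (hn : 4 ≤ n) (α : ℝ) (hα : 1 < α) {q₀ θ : ℝ}
    {P : ℝ → Fin n → ℝ} (hP : IsNSystem n (Ici q₀) P)
    (hmu : muVec (Tbig n hn α) P = fun j : Fin (n + 1) => if (j : ℕ) = 0 then θ else 0) :
    0 ≤ θ := by
  have h1 := congrFun hmu ⟨0, by omega⟩
  simp only [muVec, if_true] at h1
  rw [← h1]
  apply le_liminf_of_le (bdd_of_abs (T_bound_ev n hn α hα hP ⟨0, by omega⟩)).2
  filter_upwards [eventually_ge_atTop q₀, eventually_gt_atTop 0] with q h1 h2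
  have h := (hP q h1).1.1 ⟨0, by omega⟩
  simp only [Tbig, if_true]
  positivity

/-- Sorting a moving value `x` into an increasing sequence `c`. -/
def SS (c : ℕ → ℝ) (x : ℝ) : ℕ → ℝ
  | 0 => min x (c 0)
  | i + 1 => max (c i) (min x (c (i + 1)))

/-- The value `x` sits at position `k` in the sequence `c`. -/
def Reg (c : ℕ → ℝ) (k : ℕ) (x : ℝ) : Prop := (∀ i, i < k → c i ≤ x) ∧ ∀ i, k ≤ i → x ≤ c i

lemma SS_reg {c : ℕ → ℝ} (hc : StrictMono c) {k : ℕ} {x : ℝ} (h : Reg c k x) (i : ℕ) :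
    SS c x i = if i < k then c i else if i = k then x else c (i - 1) := by
  rcases i with _ | i
  · rcases Nat.eq_zero_or_pos k with rfl | hk
    · simp [SS, h.2 0 le_rfl]
    · simp [SS, hk, h.1 0 hk]
  · have hi : c i < c (i + 1) := hc (Nat.lt_succ_self i)
    rcases lt_trichotomy (i + 1) k with h1 | h1 | h1
    · have := h.1 (i + 1) h1
      simp [SS, h1, min_eq_right this, hi.le]
    · have h2 := h.1 i (by omega)
      have h3 := h.2 (i + 1) (by omega)
      subst h1
      simp [SS, min_eq_left h3, h2]
    · have h2 := h.2 i (by omega)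
      have h3 := h.2 (i + 1) (by omega)
      rw [if_neg (by omega), if_neg (by omega)]
      simp [SS, min_eq_left h3, h2]

lemma SS_step {c : ℕ → ℝ} (hc : StrictMono c) {k : ℕ} {x y : ℝ} (h : Reg c k x) (h' : Reg c k y)
    (i : ℕ) : SS c y i = SS c x i + if i = k then y - x else 0 := by
  rw [SS_reg hc h, SS_reg hc h']
  split_ifs <;> first | omega | ring

lemma SS_le {c : ℕ → ℝ} (hc : StrictMono c) (x : ℝ) (i : ℕ) : SS c x i ≤ c i := by
  rcases i with _ | i
  · exact min_le_right _ _
  · exact max_le (hc (Nat.lt_succ_self i)).le (min_le_right _ _)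

lemma le_SS {c : ℕ → ℝ} (x : ℝ) (i : ℕ) : c i ≤ SS c x (i + 1) := le_max_left _ _

lemma SS_mono {c : ℕ → ℝ} (hc : StrictMono c) (x : ℝ) : Monotone (SS c x) :=
  monotone_nat_of_le_succ fun i => (SS_le hc x i).trans (le_SS x i)

lemma SS_sum {c : ℕ → ℝ} (hc : StrictMono c) (x : ℝ) (k : ℕ) :
    ∑ i ∈ Finset.range (k + 1), SS c x i = min x (c k) + ∑ i ∈ Finset.range k, c i := by
  induction k with
  | zero => simp [SS]
  | succ k ih =>
    rw [Finset.sum_range_succ, ih, Finset.sum_range_succ]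
    have h := hc (Nat.lt_succ_self k)
    simp only [SS]
    rcases le_total x (c k) with h1 | h1
    · rw [min_eq_left h1, min_eq_left (h1.trans h.le), max_eq_left h1]; ring
    · rw [min_eq_right h1, max_eq_right (le_min h1 h.le)]; ring

lemma right_exists {c : ℕ → ℝ} (hc : StrictMono c) {N : ℕ} {x : ℝ} (h : x < c N) :
    ∃ k, k ≤ N ∧ ∃ ε > 0, ∀ y ∈ Icc x (x + ε), Reg c k y := by
  classical
  have hex : ∃ k, x < c k := ⟨N, h⟩
  refine ⟨Nat.find hex, Nat.find_min' hex h, c (Nat.find hex) - x,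
    sub_pos.mpr (Nat.find_spec hex), fun y hy => ⟨fun i hi => ?_, fun i hi => ?_⟩⟩
  · have := Nat.find_min hex hi
    exact (not_lt.mp this).trans hy.1
  · have := hc.monotone hi
    linarith [hy.2]

lemma left_exists {c : ℕ → ℝ} (hc : StrictMono c) {N : ℕ} {x : ℝ} (h : x ≤ c N) :
    ∃ k, k ≤ N ∧ ∃ ε > 0, ∀ y ∈ Icc (x - ε) x, Reg c k y := by
  classical
  have hex : ∃ k, x ≤ c k := ⟨N, h⟩
  obtain ⟨ε, hε, hε2⟩ : ∃ ε > 0, ∀ i, i < Nat.find hex → c i ≤ x - ε := by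
    rcases Nat.eq_zero_or_pos (Nat.find hex) with h0 | h0
    · exact ⟨1, one_pos, fun i hi => by omega⟩
    · refine ⟨x - c (Nat.find hex - 1), ?_, fun i hi => ?_⟩
      · have := Nat.find_min hex (m := Nat.find hex - 1) (by omega)
        linarith [not_le.mp this]
      · have : c i ≤ c (Nat.find hex - 1) := hc.monotone (by omega)
        linarith
  refine ⟨Nat.find hex, Nat.find_min' hex h, ε, hε, fun y hy => ⟨fun i hi => ?_, fun i hi => ?_⟩⟩
  · exact (hε2 i hi).trans hy.1
  · exact hy.2.trans ((Nat.find_spec hex).trans (hc.monotone hi))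

/-- Gluing data for a piecewise defined system. -/
structure Glue (N : ℕ) (Q : ℕ → ℝ) (c : ℕ → ℕ → ℝ) : Prop where
  hQ : StrictMono Q
  hQt : Tendsto Q atTop atTop
  hc : ∀ s, StrictMono (c s)
  hc0 : ∀ s, 0 < c s 0
  hx0 : ∀ s, 0 < Q s - ∑ i ∈ Finset.range N, c s i
  hx1 : ∀ s, Q (s + 1) - ∑ i ∈ Finset.range N, c s i = c s N
  hm : ∀ s i, i ≤ N → SS (c s) (Q (s + 1) - ∑ i ∈ Finset.range N, c s i) i =
    SS (c (s + 1)) (Q (s + 1) - ∑ i ∈ Finset.range N, c (s + 1) i) i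

/-- The piecewise defined system. -/
def gP (N : ℕ) (Q : ℕ → ℝ) (c : ℕ → ℕ → ℝ) (q : ℝ) (i : ℕ) : ℝ :=
  SS (c (sSup {s | Q s ≤ q})) (q - ∑ i ∈ Finset.range N, c (sSup {s | Q s ≤ q}) i) i

lemma Glue.idx {N : ℕ} {Q : ℕ → ℝ} {c : ℕ → ℕ → ℝ} (G : Glue N Q c) {q : ℝ} {s : ℕ}
    (h1 : Q s ≤ q) (h2 : q < Q (s + 1)) : sSup {s | Q s ≤ q} = s := by
  apply IsGreatest.csSup_eq
  refine ⟨h1, fun t ht => ?_⟩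
  have ht : Q t ≤ q := ht
  by_contra hlt
  have := G.hQ.monotone (show s + 1 ≤ t by omega)
  linarith

lemma Glue.eq {N : ℕ} {Q : ℕ → ℝ} {c : ℕ → ℕ → ℝ} (G : Glue N Q c) {q : ℝ} {s : ℕ}
    (h1 : Q s ≤ q) (h2 : q ≤ Q (s + 1)) {i : ℕ} (hi : i ≤ N) :
    gP N Q c q i = SS (c s) (q - ∑ i ∈ Finset.range N, c s i) i := by
  rcases h2.lt_or_eq with h | h
  · rw [gP, G.idx h1 h]
  · subst h
    rw [gP, G.idx le_rfl (G.hQ (Nat.lt_succ_self (s + 1))), G.hm s i hi]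

lemma Glue.ex {N : ℕ} {Q : ℕ → ℝ} {c : ℕ → ℕ → ℝ} (G : Glue N Q c) {q : ℝ} (h : Q 0 ≤ q) :
    ∃ s, Q s ≤ q ∧ q < Q (s + 1) := by
  classical
  have hex : ∃ s, q < Q s := (G.hQt.eventually_gt_atTop q).exists
  have h0 : Nat.find hex ≠ 0 := fun h0 => by
    have := Nat.find_spec hex
    rw [h0] at this
    linarith
  refine ⟨Nat.find hex - 1, not_lt.mp (Nat.find_min hex (by omega)), ?_⟩
  have := Nat.find_spec hex
  rwa [show Nat.find hex - 1 + 1 = Nat.find hex by omega]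

lemma Glue.left {N : ℕ} {Q : ℕ → ℝ} {c : ℕ → ℕ → ℝ} (G : Glue N Q c) {q : ℝ} {s : ℕ}
    (h1 : Q s < q) (h2 : q ≤ Q (s + 1)) : ∃ l, l ≤ N ∧ Reg (c s) l (q - ∑ i ∈ Finset.range N, c s i) ∧
      ∃ ε > 0, ∀ t ∈ Icc (q - ε) q, ∀ i, i ≤ N → gP N Q c t i = gP N Q c q i + if i = l then t - q else 0 := by
  have hx : q - ∑ i ∈ Finset.range N, c s i ≤ c s N := by rw [← G.hx1 s]; linarith
  obtain ⟨l, hl, ε, hε, hreg⟩ := left_exists (G.hc s) hx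
  have hr0 := hreg _ (right_mem_Icc.mpr (by linarith))
  refine ⟨l, hl, hr0, min ε (q - Q s), lt_min hε (by linarith), fun t ht i hi => ?_⟩
  have e1 := min_le_left ε (q - Q s)
  have e2 := min_le_right ε (q - Q s)
  obtain ⟨ht1, ht2⟩ := ht
  rw [G.eq (by linarith : Q s ≤ t) (by linarith) hi, G.eq h1.le h2 hi,
    SS_step (G.hc s) hr0 (hreg _ ⟨by linarith, by linarith⟩)]
  congr 2
  ring

lemma Glue.right {N : ℕ} {Q : ℕ → ℝ} {c : ℕ → ℕ → ℝ} (G : Glue N Q c) {q : ℝ} {s : ℕ}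
    (h1 : Q s ≤ q) (h2 : q < Q (s + 1)) : ∃ l, l ≤ N ∧ Reg (c s) l (q - ∑ i ∈ Finset.range N, c s i) ∧
      ∃ ε > 0, ∀ t ∈ Icc q (q + ε), ∀ i, i ≤ N → gP N Q c t i = gP N Q c q i + if i = l then t - q else 0 := by
  have hx : q - ∑ i ∈ Finset.range N, c s i < c s N := by rw [← G.hx1 s]; linarith
  obtain ⟨l, hl, ε, hε, hreg⟩ := right_exists (G.hc s) hx
  have hr0 := hreg _ (left_mem_Icc.mpr (by linarith))
  refine ⟨l, hl, hr0, min ε (Q (s + 1) - q), lt_min hε (by linarith), fun t ht i hi => ?_⟩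
  have e1 := min_le_left ε (Q (s + 1) - q)
  have e2 := min_le_right ε (Q (s + 1) - q)
  obtain ⟨ht1, ht2⟩ := ht
  rw [G.eq (by linarith : Q s ≤ t) (by linarith) hi, G.eq h1 h2.le hi,
    SS_step (G.hc s) hr0 (hreg _ ⟨by linarith, by linarith⟩)]
  congr 2
  ring

lemma Glue.nsys {N : ℕ} {Q : ℕ → ℝ} {c : ℕ → ℕ → ℝ} (G : Glue N Q c) :
    IsNSystem (N + 1) (Ici (Q 0)) (fun q i => gP N Q c q i) := by
  intro q hq
  obtain ⟨s, h1, h2⟩ := G.ex hq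
  have hP : ∀ i : Fin (N + 1), gP N Q c q i = SS (c s) (q - ∑ i ∈ Finset.range N, c s i) i :=
    fun i => G.eq h1 h2.le (by omega)
  have hx0 : 0 < q - ∑ i ∈ Finset.range N, c s i := by linarith [G.hx0 s]
  have hxN : q - ∑ i ∈ Finset.range N, c s i ≤ c s N := by rw [← G.hx1 s]; linarith
  refine ⟨⟨fun i => ?_, fun i j hij => ?_, ?_⟩, ?_⟩
  · simp only [hP]
    exact le_trans (le_min hx0.le (G.hc0 s).le) (SS_mono (G.hc s) _ (Nat.zero_le i))
  · simp only [hP]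
    exact SS_mono (G.hc s) _ hij
  · simp only [hP]
    rw [Fin.sum_univ_eq_sum_range (fun i => SS (c s) (q - ∑ i ∈ Finset.range N, c s i) i),
      SS_sum (G.hc s), min_eq_left hxN]
    ring
  · obtain ⟨k, hk, hkr, ε, hε, hR⟩ := G.right h1 h2
    have main : ∀ l, l ≤ N → ∀ ε' > 0, (∀ t ∈ Ici (Q 0) ∩ Icc (q - ε') q, ∀ i, i ≤ N →
        gP N Q c t i = gP N Q c q i + if i = l then t - q else 0) →
        (l < k → Reg (c s) l (q - ∑ i ∈ Finset.range N, c s i)) →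
        ∃ ε > 0, ∃ k ℓ : Fin (N + 1),
      (∀ t ∈ Ici (Q 0) ∩ Icc (q - ε) q, (fun i : Fin (N + 1) => gP N Q c t i) =
        (fun i : Fin (N + 1) => gP N Q c q i) + Pi.single ℓ (t - q)) ∧
      (∀ t ∈ Ici (Q 0) ∩ Icc q (q + ε), (fun i : Fin (N + 1) => gP N Q c t i) =
        (fun i : Fin (N + 1) => gP N Q c q i) + Pi.single k (t - q)) ∧
      (q ∈ interior (Ici (Q 0)) → ℓ < k → ∀ i : Fin (N + 1), ℓ ≤ i → i ≤ k →
        gP N Q c q i = gP N Q c q ℓ) := by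
      intro l hl ε' hε' hL hlr
      refine ⟨min ε ε', lt_min hε hε', ⟨k, by omega⟩, ⟨l, by omega⟩, ?_, ?_, ?_⟩
      · rintro t ⟨ht0, ht1, ht2⟩
        have := min_le_right ε ε'
        ext i
        rw [hL t ⟨ht0, by linarith, ht2⟩ i (by omega)]
        simp [Pi.single_apply, Fin.ext_iff]
      · rintro t ⟨ht0, ht1, ht2⟩
        have := min_le_left ε ε'
        ext i
        rw [hR t ⟨ht1, by linarith⟩ i (by omega)]
        simp [Pi.single_apply, Fin.ext_iff]
      · intro _ hlk i hi1 hi2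
        have hlk : l < k := hlk
        have hlr := hlr hlk
        have e1 := hkr.1 l hlk
        have e2 := hlr.2 l le_rfl
        have hkl : k = l + 1 := by
          by_contra hne
          have e3 := hkr.1 (l + 1) (by omega)
          have e4 := G.hc s (Nat.lt_succ_self l)
          simp only [Nat.succ_eq_add_one] at e4
          linarith
        rw [hP i, hP ⟨l, by omega⟩, SS_reg (G.hc s) hlr, SS_reg (G.hc s) hlr]
        simp only [lt_irrefl, if_false, if_true]
        have hi1 : l ≤ (i : ℕ) := hi1
        have hi2 : (i : ℕ) ≤ k := hi2
        rw [if_neg (by omega)]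
        split_ifs with h5
        · rfl
        · rw [show (i : ℕ) - 1 = l by omega]; linarith
    rcases h1.lt_or_eq with h1' | h1'
    · obtain ⟨l, hl, hlr, ε', hε', hL⟩ := G.left h1' h2.le
      exact main l hl ε' hε' (fun t ht => hL t ht.2) (fun _ => hlr)
    · rcases s with _ | s
      · refine main N le_rfl 1 one_pos (fun t ht i hi => ?_) (fun h => by omega)
        have : t = q := le_antisymm ht.2.2 (h1' ▸ ht.1)
        simp [this]
      · obtain ⟨l, hl, hlr, ε', hε', hL⟩ := G.left (s := s) (q := q)
          (by rw [← h1']; exact G.hQ (Nat.lt_succ_self s)) h1'.ge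
        have hlN : N ≤ l := by
          by_contra hlt
          have e1 := hlr.2 l le_rfl
          rw [← h1', G.hx1 s] at e1
          have := G.hc s (not_le.mp hlt)
          linarith
        exact main l hl ε' hε' (fun t ht => hL t ht.2) (fun h => by omega)

/-- The exponent of the smallest coordinate. -/
def aS (g : ℕ → ℕ) : ℕ → ℕ
  | 0 => 0
  | s + 1 => if aS g s + g (aS g s) ≤ s + 1 then s + 1 else aS g s

lemma aS_le (g : ℕ → ℕ) (s : ℕ) : aS g s ≤ s := by
  induction s with
  | zero => simp [aS]
  | succ s ih => simp only [aS]; split_ifs <;> omega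

lemma le_aS (g : ℕ → ℕ) (hg : ∀ a, 1 ≤ g a) (s : ℕ) : s + 1 ≤ aS g s + g (aS g s) := by
  induction s with
  | zero => have := hg 0; simp [aS]; omega
  | succ s ih =>
    simp only [aS]
    split_ifs with h
    · have := hg (s + 1); omega
    · omega

lemma aS_mono (g : ℕ → ℕ) : Monotone (aS g) := by
  apply monotone_nat_of_le_succ
  intro s
  have := aS_le g s
  simp only [aS]
  split_ifs <;> omega

lemma aS_succ (g : ℕ → ℕ) (s : ℕ) : aS g (s + 1) = s + 1 ∨ aS g (s + 1) = aS g s := by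
  simp only [aS]
  split_ifs <;> simp

lemma aS_freq (g : ℕ → ℕ) (hg : ∀ a, 1 ≤ g a) (M : ℕ) :
    ∃ s, M ≤ s ∧ aS g (s + 1) = s + 1 ∧ aS g s + g (aS g s) = s + 1 := by
  by_contra hcon
  push Not at hcon
  have hno : ∀ s, M ≤ s → ¬ (aS g s + g (aS g s) ≤ s + 1) := by
    intro s hs hle
    have h1 : aS g (s + 1) = s + 1 := by simp [aS, hle]
    exact hcon s hs h1 (le_antisymm hle (le_aS g hg s))
  have hconst : ∀ d, aS g (M + d) = aS g M := by
    intro d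
    induction d with
    | zero => rfl
    | succ d ih =>
      have := hno (M + d) (by omega)
      rw [← ih, ← add_assoc]
      simp [aS, this]
  have := hno (M + g (aS g M)) (by omega)
  rw [hconst] at this
  have h2 := aS_le g M
  omega

/-- The increasing sequence of fixed values in piece `s`. -/
def cS (α : ℝ) (g : ℕ → ℕ) (s i : ℕ) : ℝ := if i = 0 then α ^ aS g (s + 1) else α ^ (s + 1 + i)

/-- The endpoints of the pieces. -/
def QS (N : ℕ) (α : ℝ) (g : ℕ → ℕ) (s : ℕ) : ℝ :=
  α ^ aS g s + ∑ i ∈ Finset.range N, α ^ (s + 1 + i)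

lemma cS_strictMono {α : ℝ} (hα : 1 < α) (g : ℕ → ℕ) (s : ℕ) : StrictMono (cS α g s) := by
  apply strictMono_nat_of_lt_succ
  intro i
  have := aS_le g (s + 1)
  unfold cS
  rw [if_neg (by omega : i + 1 ≠ 0)]
  split_ifs with h
  · exact pow_lt_pow_right₀ hα (by omega)
  · exact pow_lt_pow_right₀ hα (by omega)

lemma cS_sum {α : ℝ} (g : ℕ → ℕ) (s N : ℕ) (hN : 1 ≤ N) :
    ∑ i ∈ Finset.range N, cS α g s i =
      α ^ aS g (s + 1) - α ^ (s + 1) + ∑ i ∈ Finset.range N, α ^ (s + 1 + i) := by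
  obtain ⟨M, rfl⟩ : ∃ M, N = M + 1 := ⟨N - 1, by omega⟩
  rw [Finset.sum_range_succ', Finset.sum_range_succ']
  simp [cS]
  ring

lemma xS_start {α : ℝ} (g : ℕ → ℕ) (s N : ℕ) (hN : 1 ≤ N) :
    QS N α g s - ∑ i ∈ Finset.range N, cS α g s i = α ^ aS g s + α ^ (s + 1) - α ^ aS g (s + 1) := by
  rw [cS_sum g s N hN, QS]; ring

lemma xS_end {α : ℝ} (g : ℕ → ℕ) (s N : ℕ) (hN : 1 ≤ N) :
    QS N α g (s + 1) - ∑ i ∈ Finset.range N, cS α g s i = cS α g s N := by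
  rw [cS_sum g s N hN, QS]
  have h := Finset.sum_range_succ (fun i => α ^ (s + 1 + i)) N
  rw [Finset.sum_range_succ'] at h
  have h2 : ∑ i ∈ Finset.range N, α ^ (s + 1 + 1 + i) = ∑ i ∈ Finset.range N, α ^ (s + 1 + (i + 1)) := by
    apply Finset.sum_congr rfl
    intro i _
    congr 1
    ring
  rw [h2, cS, if_neg (by omega)]
  simp only [add_zero] at h
  linarith

lemma xS_start_ge {α : ℝ} (hα : 1 < α) (g : ℕ → ℕ) (s : ℕ) :
    α ^ aS g s ≤ α ^ aS g s + α ^ (s + 1) - α ^ aS g (s + 1) := by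
  have := pow_le_pow_right₀ hα.le (aS_le g (s + 1))
  linarith

lemma xS_start_le {α : ℝ} (hα : 1 < α) (g : ℕ → ℕ) (s : ℕ) :
    α ^ aS g s + α ^ (s + 1) - α ^ aS g (s + 1) ≤ α ^ (s + 1) := by
  have := pow_le_pow_right₀ hα.le (aS_mono g (Nat.le_succ s))
  simp only [Nat.succ_eq_add_one] at this
  linarith

lemma SS_start {α : ℝ} (hα : 1 < α) (g : ℕ → ℕ) (s N : ℕ) (hN : 1 ≤ N) (i : ℕ) :
    SS (cS α g s) (QS N α g s - ∑ i ∈ Finset.range N, cS α g s i) i =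
      if i = 0 then α ^ aS g s else α ^ (s + i) := by
  rw [xS_start g s N hN]
  have hc := cS_strictMono hα g s
  rcases aS_succ g s with h | h
  · rw [h, add_sub_cancel_right, SS_reg hc (k := 0)]
    · rcases i with _ | i
      · simp
      · rcases i with _ | i
        · simp [cS, h]
        · simp [cS]; congr 1; ring
    · refine ⟨by simp, fun i _ => ?_⟩
      refine le_trans ?_ (hc.monotone (Nat.zero_le i))
      simp only [cS, if_true]
      exact pow_le_pow_right₀ hα.le (aS_mono g (Nat.le_succ s))
  · rw [h, add_sub_cancel_left, SS_reg hc (k := 1)]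
    · rcases i with _ | i
      · simp [cS, h]
      · rcases i with _ | i
        · simp
        · simp [cS]; congr 1; ring
    · refine ⟨fun i hi => ?_, fun i hi => ?_⟩
      · have : i = 0 := by omega
        subst this
        simp only [cS, if_true]
        exact pow_le_pow_right₀ hα.le (aS_le g (s + 1))
      · simp only [cS]
        rw [if_neg (by omega)]
        exact pow_le_pow_right₀ hα.le (by omega)

lemma glueS {α : ℝ} (hα : 1 < α) (g : ℕ → ℕ) (N : ℕ) (hN : 1 ≤ N) :
    Glue N (QS N α g) (cS α g) where
  hQ := by
    apply strictMono_nat_of_lt_succ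
    intro s
    have h1 := xS_start (α := α) g s N hN
    have h2 := xS_end (α := α) g s N hN
    have h3 := xS_start_le hα g s
    have h4 : α ^ (s + 1) < cS α g s N := by
      rw [cS, if_neg (by omega)]
      exact pow_lt_pow_right₀ hα (by omega)
    linarith
  hQt := by
    refine tendsto_atTop_mono (fun s => ?_) (tendsto_pow_atTop_atTop_of_one_lt hα)
    have h1 : α ^ s ≤ α ^ (s + 1 + 0) := pow_le_pow_right₀ hα.le (by omega)
    have h2 := Finset.single_le_sum (f := fun i => α ^ (s + 1 + i)) (s := Finset.range N)
      (fun i _ => by positivity) (Finset.mem_range.mpr (show 0 < N by omega))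
    have h3 : 0 < α ^ aS g s := by positivity
    rw [QS]
    linarith
  hc := cS_strictMono hα g
  hc0 := fun s => by simp only [cS, if_true]; positivity
  hx0 := fun s => by
    rw [xS_start g s N hN]
    refine lt_of_lt_of_le ?_ (xS_start_ge hα g s)
    positivity
  hx1 := fun s => xS_end g s N hN
  hm := fun s i hi => by
    rw [SS_start hα g (s + 1) N hN, xS_end g s N hN, SS_reg (cS_strictMono hα g s) (k := N)]
    · split_ifs with h1 h2 h2 h3
      · simp [cS, h2]
      · simp [cS, h2]
      · omega
      · subst h2; simp [cS, h3]
      · omega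
      · omega
    · exact ⟨fun i hi => (cS_strictMono hα g s hi).le, fun i hi => (cS_strictMono hα g s).monotone hi⟩

lemma freq_of {Q : ℕ → ℝ} (hQt : Tendsto Q atTop atTop) {p : ℝ → Prop}
    (h : ∀ M, ∃ s, M ≤ s ∧ ∃ q, Q s ≤ q ∧ p q) : ∃ᶠ q in atTop, p q := by
  rw [frequently_atTop]
  intro b
  obtain ⟨M, hM⟩ := (hQt.eventually_ge_atTop b).exists_forall_of_atTop
  obtain ⟨s, hs, q, hq, hp⟩ := h M
  exact ⟨q, (hM s hs).trans hq, hp⟩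

lemma construct (N : ℕ) (hN : 3 ≤ N) (hn : 4 ≤ N + 1) (α : ℝ) (hα : 1 < α) (g : ℕ → ℕ)
    (hg : ∀ a, 1 ≤ g a) (θ : ℝ) (hθ0 : 0 ≤ θ) (hθ1 : θ ≤ 1)
    (hlow : ∀ s, θ * QS N α g s ≤ α ^ aS g s)
    (hfr : ∀ ε > 0, ∀ M, ∃ s, M ≤ s ∧ α ^ aS g s ≤ (θ + ε) * QS N α g s) :
    ∃ q₀ : ℝ, 0 ≤ q₀ ∧ ∃ P : ℝ → Fin (N + 1) → ℝ,
        IsNSystem (N + 1) (Ici q₀) P ∧ IsProper (N + 1) P ∧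
        muVec (Tbig (N + 1) hn α) P = fun j : Fin (N + 1 + 1) => if (j : ℕ) = 0 then θ else 0 := by
  have hN1 : 1 ≤ N := by omega
  have G := glueS hα g N hN1
  have hQpos : ∀ s, 0 < QS N α g s := fun s => by unfold QS; positivity
  have hsys := G.nsys
  set Q := QS N α g with hQdef
  set c := cS α g with hcdef
  have hci : ∀ s i, 1 ≤ i → c s i = α ^ (s + 1 + i) := fun s i hi => by
    rw [hcdef, cS, if_neg (by omega)]
  have hc0 : ∀ s, c s 0 = α ^ aS g (s + 1) := fun s => by simp [hcdef, cS]
  have hc0le : ∀ s, c s 0 ≤ α ^ (s + 1) := fun s => by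
    rw [hc0]; exact pow_le_pow_right₀ hα.le (aS_le g _)
  have hx : ∀ s q, Q s ≤ q →
      α ^ aS g s + α ^ (s + 1) - α ^ aS g (s + 1) ≤ q - ∑ i ∈ Finset.range N, c s i := by
    intro s q h
    have := xS_start (α := α) g s N hN1
    linarith
  -- lower bound for the first coordinate
  have hP0 : ∀ s q, Q s ≤ q → q ≤ Q (s + 1) → α ^ aS g s ≤ gP N Q c q 0 := by
    intro s q h1 h2
    rw [G.eq h1 h2 (Nat.zero_le _)]
    refine le_min ((xS_start_ge hα g s).trans (hx s q h1)) ?_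
    rw [hc0]
    exact pow_le_pow_right₀ hα.le (aS_mono g (Nat.le_succ s))
  have hP0' : ∀ s q, Q s ≤ q → q ≤ Q (s + 1) → θ * q ≤ gP N Q c q 0 := by
    intro s q h1 h2
    rw [G.eq h1 h2 (Nat.zero_le _)]
    refine le_min ?_ ?_
    · have e1 := hlow s
      have e2 := xS_start (α := α) g s N hN1
      have e3 := xS_start_ge hα g s
      have e4 : θ * (q - Q s) ≤ 1 * (q - Q s) := mul_le_mul_of_nonneg_right hθ1 (by linarith)
      linarith
    · rw [hc0]
      exact (mul_le_mul_of_nonneg_left h2 hθ0).trans (hlow (s + 1))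
  have hPj : ∀ s q j, 1 ≤ j → j ≤ N → Q s ≤ q → q ≤ Q (s + 1) → α ^ (s + j) ≤ gP N Q c q j := by
    intro s q j hj hjN h1 h2
    rw [G.eq h1 h2 hjN]
    obtain ⟨j, rfl⟩ : ∃ i, j = i + 1 := ⟨j - 1, by omega⟩
    simp only [SS]
    rcases j with _ | j
    · rcases aS_succ g s with h | h
      · refine le_max_of_le_left ?_
        rw [hc0, h]
      · refine le_max_of_le_right (le_min ?_ ?_)
        · have := hx s q h1
          rw [h] at this
          simp only [zero_add]
          linarith
        · rw [hci _ _ (by omega)]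
          exact pow_le_pow_right₀ hα.le (by omega)
    · refine le_max_of_le_left ?_
      rw [hci _ _ (by omega)]
      exact pow_le_pow_right₀ hα.le (by omega)
  have hnn : ∀ s q, Q s ≤ q → q ≤ Q (s + 1) → ∀ j : Fin (N + 1 + 1), (j : ℕ) ≠ 0 →
      0 ≤ Tbig (N + 1) hn α (fun i => gP N Q c q i) j := by
    intro s q h1 h2 j hj
    have hNlow : α ^ (s + N) ≤ gP N Q c q N := hPj s q N hN1 le_rfl h1 h2
    unfold Tbig
    simp only [hj, if_false]
    split_ifs with hj1 hj2
    · have e1 := hPj s q j (by omega) (by omega) h1 h2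
      have e2 : c s j ≤ α * gP N Q c q j := by
        rw [hci s j (by omega)]
        calc α ^ (s + 1 + (j : ℕ)) = α * α ^ (s + (j : ℕ)) := by ring
          _ ≤ _ := by gcongr
      have e3 : min (q - ∑ i ∈ Finset.range N, c s i) (c s (j + 1)) ≤ α * gP N Q c q j := by
        rcases le_total (q - ∑ i ∈ Finset.range N, c s i) (c s j) with h | h
        · exact (min_le_left _ _).trans (h.trans e2)
        · refine (min_le_right _ _).trans ?_
          have e4 : c s j ≤ gP N Q c q j := by
            rw [G.eq h1 h2 (by omega)]
            obtain ⟨i, hi⟩ : ∃ i, (j : ℕ) = i + 1 := ⟨j - 1, by omega⟩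
            rw [hi] at h ⊢
            simp only [SS]
            rw [min_eq_right h]
            exact le_max_right _ _
          calc c s (j + 1) = α * c s j := by rw [hci _ _ (by omega), hci _ _ (by omega)]; ring
            _ ≤ _ := by gcongr
      rw [G.eq (i := (j : ℕ) + 1) h1 h2 (by omega)]
      simp only [SS]
      linarith [max_le e2 e3]
    · have e1 : gP N Q c q 1 ≤ α ^ (s + 2) := by
        rw [G.eq h1 h2 hN1]
        refine (SS_le (G.hc s) _ _).trans ?_
        rw [hci _ _ le_rfl]
      have e2 : α ^ (N + 1 - 3) * gP N Q c q 1 ≤ α ^ (s + N) := by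
        calc α ^ (N + 1 - 3) * gP N Q c q 1 ≤ α ^ (N + 1 - 3) * α ^ (s + 2) := by gcongr
          _ = _ := by rw [← pow_add]; congr 1; omega
      simp only [Nat.add_sub_cancel]
      linarith
    · have e1 : gP N Q c q 0 ≤ α ^ (s + 1) := by
        rw [G.eq h1 h2 (Nat.zero_le _)]
        exact (SS_le (G.hc s) _ _).trans (hc0le s)
      have e2 : α ^ (N + 1 - 2) * gP N Q c q 0 ≤ α ^ (s + N) := by
        calc α ^ (N + 1 - 2) * gP N Q c q 0 ≤ α ^ (N + 1 - 2) * α ^ (s + 1) := by gcongr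
          _ = _ := by rw [← pow_add]; congr 1; omega
      simp only [Nat.add_sub_cancel]
      linarith
  -- the zeros
  have hzero : ∀ j : Fin (N + 1 + 1), (j : ℕ) ≠ 0 → ∀ M, ∃ s, M ≤ s ∧ ∃ q, Q s ≤ q ∧
      Tbig (N + 1) hn α (fun i => gP N Q c q i) j = 0 := by
    intro j hj M
    unfold Tbig
    simp only [hj, if_false]
    have hreg : ∀ s k, Reg (c s) k (c s k) := fun s k =>
      ⟨fun i hi => (G.hc s hi).le, fun i hi => (G.hc s).monotone hi⟩
    have hval : ∀ s k, k ≤ N → α ^ aS g s + α ^ (s + 1) - α ^ aS g (s + 1) ≤ c s k →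
        ∃ q, Q s ≤ q ∧ ∀ i, i ≤ N → gP N Q c q i = SS (c s) (c s k) i := by
      intro s k hk hle
      have e1 := xS_start (α := α) g s N hN1
      have e2 := xS_end (α := α) g s N hN1
      have e3 := (G.hc s).monotone hk
      have h1 : Q s ≤ c s k + ∑ i ∈ Finset.range N, c s i := by linarith
      have h2 : c s k + ∑ i ∈ Finset.range N, c s i ≤ Q (s + 1) := by linarith
      refine ⟨c s k + ∑ i ∈ Finset.range N, c s i, h1, fun i hi => ?_⟩
      rw [G.eq h1 h2 hi, add_sub_cancel_right]
    split_ifs with hj1 hj2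
    · refine ⟨M, le_rfl, Q M, le_rfl, ?_⟩
      have hQM := (G.hQ (Nat.lt_succ_self M)).le
      rw [G.eq le_rfl hQM (by omega : (j : ℕ) ≤ N), G.eq le_rfl hQM (by omega : (j : ℕ) + 1 ≤ N),
        SS_start hα g M N hN1, SS_start hα g M N hN1, if_neg hj, if_neg (by omega)]
      ring
    · obtain ⟨q, hq, hv⟩ := hval M 1 hN1 (by
        rw [hci _ _ le_rfl]
        exact (xS_start_le hα g M).trans (pow_le_pow_right₀ hα.le (by omega)))
      refine ⟨M, le_rfl, q, hq, ?_⟩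
      simp only [Nat.add_sub_cancel]
      rw [hv N le_rfl, hv 1 hN1, SS_reg (G.hc M) (hreg M 1), SS_reg (G.hc M) (hreg M 1),
        if_neg (by omega), if_neg (by omega), if_neg (by omega), if_pos rfl, hci _ _ le_rfl,
        hci _ _ (by omega), ← pow_add, sub_eq_zero]
      congr 1
      omega
    · obtain ⟨s, hs, hL, -⟩ := aS_freq g hg M
      obtain ⟨q, hq, hv⟩ := hval s 0 (Nat.zero_le _) (by
        rw [hc0, hL]
        have := xS_start_le hα g s
        rwa [hL] at this)
      refine ⟨s, hs, q, hq, ?_⟩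
      simp only [Nat.add_sub_cancel]
      rw [hv N le_rfl, hv 0 (Nat.zero_le _), SS_reg (G.hc s) (hreg s 0), SS_reg (G.hc s) (hreg s 0),
        if_neg (by omega), if_neg (by omega), if_neg (by omega), if_pos rfl, hc0, hL,
        hci _ _ (by omega), ← pow_add, sub_eq_zero]
      congr 1
      omega
  refine ⟨Q 0, (hQpos 0).le, fun q i => gP N Q c q i, hsys, ?_, ?_⟩
  · intro i
    rw [tendsto_atTop]
    intro b
    obtain ⟨S, hS⟩ := (tendsto_pow_atTop_atTop_of_one_lt hα).eventually_ge_atTop b |>.exists_forall_of_atTop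
    obtain ⟨S', hS', hL, -⟩ := aS_freq g hg S
    filter_upwards [eventually_ge_atTop (Q (S' + 1))] with q hq
    have hq0 : Q 0 ≤ q := (G.hQ.monotone (Nat.zero_le _)).trans hq
    obtain ⟨s, h1, h2⟩ := G.ex hq0
    have hs : S' + 1 ≤ s := by
      by_contra hlt
      have := G.hQ.monotone (show s + 1 ≤ S' + 1 by omega)
      linarith
    have e1 := hP0 s q h1 h2.le
    have e2 := aS_mono g hs
    have e3 := hS (aS g s) (by omega)
    have e4 : gP N Q c q 0 ≤ gP N Q c q i := by
      rw [G.eq h1 h2.le (Nat.zero_le _), G.eq h1 h2.le (by omega : (i : ℕ) ≤ N)]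
      exact SS_mono (G.hc s) _ (Nat.zero_le _)
    linarith
  · funext j
    have hb := T_bound_ev (N + 1) hn α hα hsys j
    unfold muVec
    by_cases hj : (j : ℕ) = 0
    · simp only [hj, if_true]
      have hT : ∀ x : Fin (N + 1) → ℝ, Tbig (N + 1) hn α x j = x ⟨0, by omega⟩ := fun x => by
        simp [Tbig, hj]
      apply liminf_eq_of hb
      · filter_upwards [eventually_ge_atTop (Q 0)] with q hq
        obtain ⟨s, h1, h2⟩ := G.ex hq
        rw [hT, le_div_iff₀ (lt_of_lt_of_le (hQpos 0) hq)]
        exact hP0' s q h1 h2.le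
      · intro ε hε
        apply freq_of G.hQt
        intro M
        obtain ⟨s, hs, hle⟩ := hfr ε hε M
        refine ⟨s, hs, Q s, le_rfl, ?_⟩
        rw [hT, div_le_iff₀ (hQpos s)]
        simp only
        rw [G.eq le_rfl (G.hQ (Nat.lt_succ_self s)).le (Nat.zero_le _), SS_start hα g s N hN1]
        simpa using hle
    · simp only [hj, if_false]
      apply liminf_eq_of hb
      · filter_upwards [eventually_ge_atTop (Q 0)] with q hq
        obtain ⟨s, h1, h2⟩ := G.ex hq
        exact div_nonneg (hnn s q h1 h2.le j hj) ((hQpos 0).le.trans hq)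
      · intro ε hε
        apply freq_of G.hQt
        intro M
        obtain ⟨s, hs, q, hq, hz⟩ := hzero j hj M
        refine ⟨s, hs, q, hq, ?_⟩
        rw [hz, zero_div]
        linarith

lemma QS_eq (N : ℕ) (α : ℝ) (g : ℕ → ℕ) (s : ℕ) :
    QS N α g s = α ^ aS g s + α ^ (s + 1) * ∑ i ∈ Finset.range N, α ^ i := by
  rw [QS, Finset.mul_sum]
  simp only [pow_add]

lemma construct_pos (N : ℕ) (hN : 3 ≤ N) (hn : 4 ≤ N + 1) (α : ℝ) (hα : 1 < α) (m : ℕ) (hm : 0 < m) :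
    ∃ q₀ : ℝ, 0 ≤ q₀ ∧ ∃ P : ℝ → Fin (N + 1) → ℝ,
        IsNSystem (N + 1) (Ici q₀) P ∧ IsProper (N + 1) P ∧
        muVec (Tbig (N + 1) hn α) P = fun j : Fin (N + 1 + 1) => if (j : ℕ) = 0 then
          (1 + α ^ m * ∑ i ∈ Finset.range N, α ^ i)⁻¹ else 0 := by
  have hβ : 0 ≤ ∑ i ∈ Finset.range N, α ^ i := Finset.sum_nonneg fun i _ => by positivity
  have hK : 1 ≤ 1 + α ^ m * ∑ i ∈ Finset.range N, α ^ i := by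
    have : 0 ≤ α ^ m * ∑ i ∈ Finset.range N, α ^ i := by positivity
    linarith
  have hKpos : 0 < 1 + α ^ m * ∑ i ∈ Finset.range N, α ^ i := by linarith
  have hQ : ∀ s, 0 ≤ QS N α (fun _ => m) s := fun s => by unfold QS; positivity
  refine construct N hN hn α hα (fun _ => m) (fun _ => hm) _ (by positivity) (inv_le_one_of_one_le₀ hK) ?_ ?_
  · intro s
    have h := le_aS (fun _ => m) (fun _ => hm) s
    rw [inv_mul_le_iff₀ hKpos, QS_eq]
    have := pow_le_pow_right₀ hα.le h
    have := mul_le_mul_of_nonneg_right this hβ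
    rw [pow_add α (aS _ _)] at this
    linarith
  · intro ε hε M
    obtain ⟨s, hs, -, h⟩ := aS_freq (fun _ => m) (fun _ => hm) M
    refine ⟨s, hs, ?_⟩
    have e : α ^ aS (fun _ => m) s = (1 + α ^ m * ∑ i ∈ Finset.range N, α ^ i)⁻¹ * QS N α (fun _ => m) s := by
      rw [eq_inv_mul_iff_mul_eq₀ hKpos.ne', QS_eq, ← h, pow_add]
      ring
    have := mul_nonneg hε.le (hQ s)
    rw [add_mul, ← e]
    linarith

lemma construct_zero (N : ℕ) (hN : 3 ≤ N) (hn : 4 ≤ N + 1) (α : ℝ) (hα : 1 < α) :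
    ∃ q₀ : ℝ, 0 ≤ q₀ ∧ ∃ P : ℝ → Fin (N + 1) → ℝ,
        IsNSystem (N + 1) (Ici q₀) P ∧ IsProper (N + 1) P ∧
        muVec (Tbig (N + 1) hn α) P = fun j : Fin (N + 1 + 1) => if (j : ℕ) = 0 then 0 else 0 := by
  refine construct N hN hn α hα (fun a => a + 1) (fun _ => by omega) 0 le_rfl zero_le_one ?_ ?_
  · intro s
    rw [zero_mul]
    positivity
  · intro ε hε M
    obtain ⟨S, hS⟩ := (tendsto_pow_atTop_atTop_of_one_lt hα).eventually_ge_atTop ε⁻¹ |>.exists_forall_of_atTop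
    obtain ⟨s, hs, -, h⟩ := aS_freq (fun a => a + 1) (fun _ => by omega) (M + 2 * S)
    refine ⟨s, by omega, ?_⟩
    have e1 := hS (aS (fun a => a + 1) s + 1) (by omega)
    have hβ : 1 ≤ ∑ i ∈ Finset.range N, α ^ i := by
      have := Finset.single_le_sum (f := fun i => α ^ i) (s := Finset.range N)
        (fun i _ => by positivity) (Finset.mem_range.mpr (show 0 < N by omega))
      simpa using this
    have e2 : α ^ (s + 1) ≤ QS N α (fun a => a + 1) s := by
      rw [QS_eq]
      have h1 : 0 < α ^ aS (fun a => a + 1) s := by positivity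
      have h2 : 0 < α ^ (s + 1) := by positivity
      nlinarith
    rw [zero_add]
    calc α ^ aS (fun a => a + 1) s = ε * (α ^ aS (fun a => a + 1) s * ε⁻¹) := by
          field_simp
      _ ≤ ε * (α ^ aS (fun a => a + 1) s * α ^ (aS (fun a => a + 1) s + 1)) := by gcongr
      _ = ε * α ^ (s + 1) := by rw [← pow_add, h]
      _ ≤ _ := by gcongr

theorem stmt_18 (n : ℕ) (hn : 4 ≤ n) (α : ℝ) (hα : 1 < α) :
    {θ : ℝ | ∃ q₀ : ℝ, 0 ≤ q₀ ∧ ∃ P : ℝ → Fin n → ℝ,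
        IsNSystem n (Ici q₀) P ∧ IsProper n P ∧
        muVec (Tbig n hn α) P = fun j : Fin (n + 1) => if (j : ℕ) = 0 then θ else 0} =
      {0} ∪ {θ : ℝ | ∃ m : ℕ, 0 < m ∧
        θ = (1 + α ^ m * ∑ i ∈ Finset.range (n - 1), α ^ i)⁻¹} := by
  ext θ
  constructor
  · rintro ⟨q₀, hq₀, P, hP, hprop, hmu⟩
    rcases (theta_nonneg n hn α hα hP hmu).eq_or_lt with h | h
    · exact Or.inl h.symm
    · exact Or.inr (forward n hn α hα h hP hprop hmu)
  · obtain ⟨N, rfl⟩ : ∃ N, n = N + 1 := ⟨n - 1, by omega⟩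
    rintro (h | ⟨m, hm, rfl⟩)
    · have h : θ = 0 := h
      subst h
      exact construct_zero N (by omega) hn α hα
    · exact construct_pos N (by omega) hn α hα m hm
end
end
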